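/- arXiv:1901.09058 — 3 statements merged into one kernel-verified Lean document; each statement's English description precedes it below -/
import Mathlib

section
/- For every integer k ≥ 2 and every real ε ∈ (0,1), there exists t₀ such that for every integer t ≥ t₀ there exist an integer n with n ≥ (1−ε)·(√2/e)·t·2^{t/2}, a covering k-uniform hypergraph H on n vertices, and a 2-edge-coloring of H containing no monochromatic Berge copy of the complete graph K_t. In particular, R̂^k(BK_t, BK_t) > (1+o(1))·(√2/e)·t·2^{t/2} as t → ∞. -/
/-- `G` has a Berge copy in the hypergraph `H` (a finite set of edges, each a finite
set of vertices) all of whose hyperedges satisfy the predicate `P`: there are distinct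
core vertices `y v` (one for each vertex `v` of `G`) and distinct hyperedges `f e`
(one for each edge `e` of `G`) such that each edge `e = uv` of `G` satisfies
`{y u, y v} ⊆ f e`. -/
def HasBergeCopy {α V : Type*} (G : SimpleGraph α) (H : Finset (Finset V))
    (P : Finset V → Prop) : Prop :=
  ∃ (y : α → V) (f : Sym2 α → Finset V),
    Function.Injective y ∧ Set.InjOn f G.edgeSet ∧
      ∀ e ∈ G.edgeSet, f e ∈ H ∧ P (f e) ∧ ∀ v ∈ e, y v ∈ f e

/-- local lemma counting step -/
lemma indep_step {α : Type*} [Fintype α] [DecidableEq α] (E : Finset α) (b : Bool)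
    (B : Finset (α → Bool)) (hB : ∀ c c' : α → Bool, (∀ e ∉ E, c e = c' e) → c ∈ B → c' ∈ B) :
    ((B.filter (fun c => ∀ e ∈ E, c e = b)).card : ℝ) ≤ (1/2:ℝ)^E.card * B.card := by
  have h : ((B.filter (fun c => ∀ e ∈ E, c e = b)) ×ˢ E.powerset).card ≤ B.card := by
    apply Finset.card_le_card_of_injOn
      (fun p => fun e => if e ∈ E then decide (e ∈ p.2) else p.1 e)
    · rintro ⟨c, X⟩ h
      simp only [Finset.coe_product, Set.mem_prod, Finset.mem_coe, Finset.mem_filter] at h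
      simp only [Finset.mem_coe]
      apply hB c _ _ h.1.1
      intro e he
      simp [he]
    · rintro ⟨c, X⟩ h ⟨c', X'⟩ h' heq
      simp only [Finset.coe_product, Set.mem_prod, Finset.mem_coe, Finset.mem_filter,
        Finset.mem_powerset] at h h'
      have := fun e => congrFun heq e
      simp only at this
      ext e
      · by_cases he : e ∈ E
        · change c e = c' e
          rw [h.1.2 e he, h'.1.2 e he]
        · have := this e
          simp only [he, if_false] at this
          exact this
      · by_cases he : e ∈ E
        · have := this e
          simpa [he] using this
        · exact ⟨fun q => absurd (h.2 q) he, fun q => absurd (h'.2 q) he⟩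
  rw [Finset.card_product, Finset.card_powerset] at h
  have h2 : ((B.filter (fun c => ∀ e ∈ E, c e = b)).card : ℝ) * 2 ^ E.card ≤ B.card := by
    exact_mod_cast h
  rw [one_div, inv_pow, inv_mul_eq_div, le_div_iff₀ (by positivity)]
  exact h2

lemma lll {α ι : Type*} [Fintype α] [DecidableEq α] [DecidableEq ι] (I : Finset ι)
    (E : ι → Finset α) (b : ι → Bool) (hne : ∀ i ∈ I, (E i).Nonempty)
    (h : ∀ i ∈ I, ∑ j ∈ I with ¬ Disjoint (E j) (E i), (1/2:ℝ)^(E j).card ≤ 1/4) :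
    ∃ c : α → Bool, ∀ i ∈ I, ∃ e ∈ E i, c e ≠ b i := by
  classical
  let N : Finset ι → Finset (α → Bool) := fun S =>
    Finset.univ.filter (fun c => ∀ i ∈ S, ∃ e ∈ E i, c e ≠ b i)
  let A : Finset ι → ι → Finset (α → Bool) := fun S i =>
    (N S).filter (fun c => ∀ e ∈ E i, c e = b i)
  have Nmono : ∀ S T, S ⊆ T → N T ⊆ N S := by
    intro S T hST c hc
    simp only [N, Finset.mem_filter, Finset.mem_univ, true_and] at hc ⊢
    exact fun i hi => hc i (hST hi)
  have key : ∀ S : Finset ι, S ⊆ I → ∀ i ∈ I,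
      ((A S i).card : ℝ) ≤ 2 * (1/2:ℝ)^(E i).card * (N S).card := by
    intro S
    induction S using Finset.strongInduction with
    | H S ih =>
      intro hS i hi
      let S2 := S.filter (fun j => Disjoint (E j) (E i))
      let S1 := S.filter (fun j => ¬ Disjoint (E j) (E i))
      have hS2 : S2 ⊆ S := Finset.filter_subset _ _
      have h1 : ((A S i).card : ℝ) ≤ (1/2:ℝ)^(E i).card * (N S2).card := by
        refine le_trans ?_ (indep_step (E i) (b i) (N S2) ?_)
        · have : A S i ⊆ A S2 i := Finset.filter_subset_filter _ (Nmono _ _ hS2)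
          exact_mod_cast Finset.card_le_card this
        · intro c c' hcc hc
          simp only [N, Finset.mem_filter, Finset.mem_univ, true_and] at hc ⊢
          intro j hj
          obtain ⟨e, he, hne⟩ := hc j hj
          refine ⟨e, he, ?_⟩
          rw [← hcc e]
          · exact hne
          · exact Finset.disjoint_left.1 (Finset.mem_filter.1 hj).2 he
      have h2 : ((N S2).card : ℝ) ≤ 2 * (N S).card := by
        by_cases hs : S1 = ∅
        · have : S2 = S := by
            apply Finset.filter_true_of_mem
            intro j hj
            by_contra hd
            have : j ∈ S1 := Finset.mem_filter.2 ⟨hj, hd⟩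
            simp [hs] at this
          rw [this]
          have : (0:ℝ) ≤ (N S).card := by positivity
          linarith
        · have hlt : S2 ⊂ S := by
            obtain ⟨j, hj⟩ := Finset.nonempty_iff_ne_empty.2 hs
            have hj := Finset.mem_filter.1 hj
            refine Finset.ssubset_iff_subset_ne.2 ⟨hS2, fun hh => ?_⟩
            rw [← hh] at hj
            exact hj.2 (Finset.mem_filter.1 hj.1).2
          have hsub : N S2 ⊆ N S ∪ S1.biUnion (fun j => A S2 j) := by
            intro c hc
            by_cases hcS : c ∈ N S
            · exact Finset.mem_union_left _ hcS
            · apply Finset.mem_union_right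
              simp only [N, Finset.mem_filter, Finset.mem_univ, true_and] at hcS
              push Not at hcS
              obtain ⟨j, hj, hcj⟩ := hcS
              simp only [Finset.mem_biUnion]
              refine ⟨j, Finset.mem_filter.2 ⟨hj, fun hd => ?_⟩, Finset.mem_filter.2 ⟨hc, hcj⟩⟩
              have hc2 := (Finset.mem_filter.1 hc).2 j (Finset.mem_filter.2 ⟨hj, hd⟩)
              obtain ⟨e, he, hne⟩ := hc2
              exact hne (hcj e he)
          have hcard : ((N S2).card : ℝ) ≤ (N S).card + ∑ j ∈ S1, ((A S2 j).card : ℝ) := by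
            have := (Finset.card_le_card hsub).trans
              ((Finset.card_union_le _ _).trans
                (Nat.add_le_add_left Finset.card_biUnion_le _))
            exact_mod_cast this
          have hsum : ∑ j ∈ S1, ((A S2 j).card : ℝ)
              ≤ ∑ j ∈ S1, 2 * (1/2:ℝ)^(E j).card * (N S2).card := by
            apply Finset.sum_le_sum
            intro j hj
            exact ih S2 hlt (hS2.trans hS) j (hS (Finset.mem_filter.1 hj).1)
          have hsum2 : ∑ j ∈ S1, (1/2:ℝ)^(E j).card ≤ 1/4 := by
            refine le_trans ?_ (h i hi)
            apply Finset.sum_le_sum_of_subset_of_nonneg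
            · exact Finset.filter_subset_filter _ hS
            · intros; positivity
          rw [← Finset.sum_mul, ← Finset.mul_sum] at hsum
          have : (0:ℝ) ≤ (N S2).card := by positivity
          nlinarith
      calc ((A S i).card : ℝ) ≤ (1/2:ℝ)^(E i).card * (N S2).card := h1
        _ ≤ (1/2:ℝ)^(E i).card * (2 * (N S).card) := by gcongr
        _ = _ := by ring
  have pos : ∀ S : Finset ι, S ⊆ I → 0 < (N S).card := by
    intro S
    induction S using Finset.induction_on with
    | empty =>
      intro _
      apply Finset.card_pos.2
      exact ⟨fun _ => true, by simp [N]⟩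
    | insert i S hiS ih =>
      intro hS
      have hi : i ∈ I := hS (Finset.mem_insert_self _ _)
      have hS' : S ⊆ I := (Finset.subset_insert _ _).trans hS
      have hp := ih hS'
      have hk := key S hS' i hi
      have hsub : N S ⊆ N (insert i S) ∪ A S i := by
        intro c hc
        by_cases hci : ∀ e ∈ E i, c e = b i
        · exact Finset.mem_union_right _ (Finset.mem_filter.2 ⟨hc, hci⟩)
        · apply Finset.mem_union_left
          push Not at hci
          simp only [N, Finset.mem_filter, Finset.mem_univ, true_and] at hc ⊢
          intro j hj
          rcases Finset.mem_insert.1 hj with rfl | hj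
          · exact hci
          · exact hc j hj
      have hcard : ((N S).card : ℝ) ≤ (N (insert i S)).card + (A S i).card := by
        exact_mod_cast (Finset.card_le_card hsub).trans (Finset.card_union_le _ _)
      have hpi : (1/2:ℝ)^(E i).card ≤ 1/4 := by
        refine le_trans ?_ (h i hi)
        apply Finset.single_le_sum (f := fun j => (1/2:ℝ)^(E j).card)
        · intros; positivity
        · refine Finset.mem_filter.2 ⟨hi, ?_⟩
          rw [disjoint_self]
          exact (hne i hi).ne_empty
      have hp' : (0:ℝ) < (N S).card := by exact_mod_cast hp
      have : (0:ℝ) < (N (insert i S)).card := by nlinarith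
      exact_mod_cast this
  obtain ⟨c, hc⟩ := Finset.card_pos.1 (pos I subset_rfl)
  exact ⟨c, (Finset.mem_filter.1 hc).2⟩

lemma esymm_bound {V : Type*} [DecidableEq V] (x : V → ℝ) (hx : ∀ v, 0 ≤ x v) (A : Finset V) :
    ∀ s : ℕ, ∑ W ∈ A.powersetCard s, ∏ v ∈ W, x v ≤ (∑ v ∈ A, x v)^s / s.factorial := by
  induction A using Finset.induction_on with
  | empty =>
    intro s
    cases s with
    | zero => simp
    | succ s => rw [Finset.powersetCard_eq_empty.2 (by simp)]; simp
  | insert a A ha ih =>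
    intro s
    cases s with
    | zero => simp
    | succ s =>
      rw [Finset.powersetCard_succ_insert ha, Finset.sum_union, Finset.sum_image,
        Finset.sum_insert ha]
      · have h1 := ih (s+1)
        have h2 : ∑ W ∈ A.powersetCard s, ∏ v ∈ insert a W, x v
            = x a * ∑ W ∈ A.powersetCard s, ∏ v ∈ W, x v := by
          rw [Finset.mul_sum]
          apply Finset.sum_congr rfl
          intro W hW
          rw [Finset.prod_insert]
          exact fun h => ha ((Finset.mem_powersetCard.1 hW).1 h)
        rw [h2]
        have h3 := mul_le_mul_of_nonneg_left (ih s) (hx a)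
        set S := ∑ v ∈ A, x v with hS
        have hS0 : 0 ≤ S := Finset.sum_nonneg (fun v _ => hx v)
        have hber : S^(s+1) + (s+1) * S^s * x a ≤ (x a + S)^(s+1) := by
          rw [add_comm (x a) S]
          have := pow_add_mul_le_add_pow hS0 (by have := hx a; linarith : 0 ≤ 2 * S + x a) (s+1)
          simp only [Nat.add_sub_cancel] at this
          push_cast at this
          convert this using 2
        have : S^(s+1) / ((s+1).factorial:ℝ) + x a * (S^s / (s.factorial:ℝ))
            = (S^(s+1) + (s+1) * S^s * x a) / ((s+1).factorial:ℝ) := by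
          rw [Nat.factorial_succ]; push_cast; field_simp
        calc _ ≤ S^(s+1) / ((s+1).factorial:ℝ) + x a * (S^s / (s.factorial:ℝ)) := add_le_add h1 h3
          _ = _ := this
          _ ≤ _ := by gcongr
      · intro W hW W' hW' heq
        have h1 : a ∉ W := fun h => ha ((Finset.mem_powersetCard.1 hW).1 h)
        have h2 : a ∉ W' := fun h => ha ((Finset.mem_powersetCard.1 hW').1 h)
        rw [← Finset.erase_insert h1, ← Finset.erase_insert h2, heq]
      · rw [Finset.disjoint_left]
        intro W hW hW'
        obtain ⟨W0, _, rfl⟩ := Finset.mem_image.1 hW'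
        exact ha ((Finset.mem_powersetCard.1 hW).1 (Finset.mem_insert_self _ _))

open Classical in
/-- The weight of a vertex relative to the set `J` of special vertices. -/
noncomputable def gw {V : Type*} (R : V → V → Prop) (D : ℕ) (J : Finset V) (v : V) : ℝ :=
  if ∃ z ∈ J, R v z then 2 ^ D else 1

lemma one_le_gw {V : Type*} (R : V → V → Prop) (D : ℕ) (J : Finset V) (v : V) :
    1 ≤ gw R D J v := by
  unfold gw
  split_ifs
  · exact one_le_pow₀ (by norm_num)
  · exact le_rfl

lemma gw_le {V : Type*} (R : V → V → Prop) (D : ℕ) (J : Finset V) (v : V) :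
    gw R D J v ≤ 2 ^ D := by
  unfold gw
  split_ifs
  · exact le_rfl
  · exact one_le_pow₀ (by norm_num)

open Classical in
lemma sum_gw_le {V : Type*} [Fintype V] (R : V → V → Prop) (D Mx t : ℕ) (Z J : Finset V)
    (hJ : J ⊆ Z) (hJt : J.card ≤ t)
    (hM : ∀ z ∈ Z, (Finset.univ.filter (fun v => R v z)).card ≤ Mx) :
    ∑ v, gw R D J v ≤ Fintype.card V + t * Mx * 2 ^ D := by
  have h1 : ∀ v, gw R D J v ≤ 1 + if ∃ z ∈ J, R v z then (2:ℝ) ^ D else 0 := by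
    intro v
    unfold gw
    split_ifs <;> simp
  refine (Finset.sum_le_sum (fun v _ => h1 v)).trans ?_
  rw [Finset.sum_add_distrib, ← Finset.sum_filter]
  simp only [Finset.sum_const, Finset.card_univ, nsmul_eq_mul, mul_one]
  have h2 : (Finset.univ.filter (fun v => ∃ z ∈ J, R v z)).card ≤ t * Mx := by
    have : (Finset.univ.filter (fun v => ∃ z ∈ J, R v z))
        ⊆ J.biUnion (fun z => Finset.univ.filter (fun v => R v z)) := by
      intro v hv
      simpa using hv
    refine (Finset.card_le_card this).trans ((Finset.card_biUnion_le_card_mul _ _ Mx ?_).trans ?_)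
    · intro z hz
      exact hM z (hJ hz)
    · gcongr
  have h3 : ((Finset.univ.filter (fun v => ∃ z ∈ J, R v z)).card : ℝ) ≤ t * Mx := by
    exact_mod_cast h2
  gcongr

open Classical in
lemma sum_sets {V : Type*} [Fintype V] (R : V → V → Prop) (D Mx s : ℕ) (Z : Finset V)
    (hM : ∀ z ∈ Z, (Finset.univ.filter (fun v => R v z)).card ≤ Mx) (a b : V) (hab : a ≠ b) :
    ∑ T ∈ (Finset.univ.powersetCard (s+2)).filter (fun T : Finset V => a ∈ T ∧ b ∈ T),
      ∏ v ∈ T, gw R D (T ∩ Z) v ≤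
    2 ^ (2 * D) * ((Fintype.card V + (s+2:ℕ) * Mx * 2 ^ D + 2 ^ D * Z.card : ℝ) ^ s / s.factorial) := by
  set G : ℝ := Fintype.card V + (s+2:ℕ) * Mx * 2 ^ D with hG
  have hG0 : 0 ≤ G := by positivity
  set K0 : Finset V := ({a, b} : Finset V) ∩ Z with hK0
  let Ψ : (Σ _ : ℕ, Finset V × Finset V) → ℝ := fun p =>
    2 ^ (2 * D) * (2 ^ (D * p.1) * ∏ v ∈ p.2.2, gw R D (p.2.1 ∪ K0) v)
  let Φ : Finset V → (Σ _ : ℕ, Finset V × Finset V) := fun T =>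
    ⟨((T \ {a, b}) ∩ Z).card, ((T \ {a, b}) ∩ Z, (T \ {a, b}) \ Z)⟩
  let tgt : Finset (Σ _ : ℕ, Finset V × Finset V) :=
    (Finset.range (s+1)).sigma (fun j => Z.powersetCard j ×ˢ Finset.univ.powersetCard (s - j))
  set src := (Finset.univ.powersetCard (s+2)).filter (fun T : Finset V => a ∈ T ∧ b ∈ T) with hsrc
  have hmem : ∀ T ∈ src, T.card = s + 2 ∧ ({a, b} : Finset V) ⊆ T := by
    intro T hT
    simp only [hsrc, Finset.mem_filter, Finset.mem_powersetCard, Finset.subset_univ, true_and] at hT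
    refine ⟨hT.1, ?_⟩
    intro x hx
    rcases Finset.mem_insert.1 hx with rfl | hx
    · exact hT.2.1
    · rw [Finset.mem_singleton.1 hx]; exact hT.2.2
  have hterm : ∀ T ∈ src, ∏ v ∈ T, gw R D (T ∩ Z) v ≤ Ψ (Φ T) := by
    intro T hT
    obtain ⟨hc, hs⟩ := hmem T hT
    have hJ : T ∩ Z = ((T \ {a, b}) ∩ Z) ∪ K0 := by
      rw [hK0, ← Finset.union_inter_distrib_right, Finset.sdiff_union_of_subset hs]
    rw [← Finset.prod_sdiff hs, ← Finset.prod_inter_mul_prod_sdiff (T \ {a, b}) Z]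
    simp only [Ψ, Φ]
    rw [← hJ]
    have e1 : ∏ v ∈ ({a, b} : Finset V), gw R D (T ∩ Z) v ≤ 2 ^ (2 * D) := by
      rw [Finset.prod_pair hab, two_mul, pow_add]
      have := one_le_gw R D (T ∩ Z) b
      exact mul_le_mul (gw_le _ _ _ _) (gw_le _ _ _ _) (by linarith) (by positivity)
    have e2 : ∏ v ∈ (T \ {a, b}) ∩ Z, gw R D (T ∩ Z) v ≤ 2 ^ (D * ((T \ {a, b}) ∩ Z).card) := by
      rw [pow_mul]
      rw [← Finset.prod_const]
      apply Finset.prod_le_prod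
      · intro v _
        have := one_le_gw R D (T ∩ Z) v
        linarith
      · intro v _
        exact gw_le _ _ _ _
    have p3 : 0 ≤ ∏ v ∈ (T \ {a, b}) \ Z, gw R D (T ∩ Z) v :=
      Finset.prod_nonneg (fun v _ => by have := one_le_gw R D (T ∩ Z) v; linarith)
    have p1 : 0 ≤ ∏ v ∈ ({a, b} : Finset V), gw R D (T ∩ Z) v :=
      Finset.prod_nonneg (fun v _ => by have := one_le_gw R D (T ∩ Z) v; linarith)
    rw [mul_comm]
    apply mul_le_mul e1 _ _ (by positivity)
    · exact mul_le_mul_of_nonneg_right e2 p3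
    · apply mul_nonneg _ p3
      exact Finset.prod_nonneg (fun v _ => by have := one_le_gw R D (T ∩ Z) v; linarith)
  have hinj : Set.InjOn Φ src := by
    intro T hT T' hT' h
    obtain ⟨hc, hs⟩ := hmem T hT
    obtain ⟨hc', hs'⟩ := hmem T' hT'
    simp only [Φ, Sigma.mk.injEq, heq_eq_eq, Prod.mk.injEq] at h
    rw [← Finset.sdiff_union_of_subset hs, ← Finset.sdiff_union_of_subset hs',
      ← Finset.sdiff_union_inter (T \ {a, b}) Z, ← Finset.sdiff_union_inter (T' \ {a, b}) Z,
      h.2.1, h.2.2]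
  have hmaps : ∀ T ∈ src, Φ T ∈ tgt := by
    intro T hT
    obtain ⟨hc, hs⟩ := hmem T hT
    have h1 : (T \ {a, b}).card = s := by
      rw [Finset.card_sdiff_of_subset hs, hc, Finset.card_pair hab]; rfl
    have h2 := Finset.card_inter_add_card_sdiff (T \ {a, b}) Z
    simp only [tgt, Φ, Finset.mem_sigma, Finset.mem_range, Finset.mem_product,
      Finset.mem_powersetCard, Finset.inter_subset_right, Finset.subset_univ, true_and]
    omega
  have hΨ0 : ∀ p, 0 ≤ Ψ p := by
    intro p
    have : 0 ≤ ∏ v ∈ p.2.2, gw R D (p.2.1 ∪ K0) v :=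
      Finset.prod_nonneg (fun v _ => by have := one_le_gw R D (p.2.1 ∪ K0) v; linarith)
    simp only [Ψ]
    positivity
  calc ∑ T ∈ src, ∏ v ∈ T, gw R D (T ∩ Z) v
      ≤ ∑ T ∈ src, Ψ (Φ T) := Finset.sum_le_sum hterm
    _ = ∑ p ∈ src.image Φ, Ψ p := (Finset.sum_image hinj).symm
    _ ≤ ∑ p ∈ tgt, Ψ p := by
        apply Finset.sum_le_sum_of_subset_of_nonneg
        · exact Finset.image_subset_iff.2 hmaps
        · intro p _ _; exact hΨ0 p
    _ = ∑ j ∈ Finset.range (s+1), ∑ J ∈ Z.powersetCard j,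
          ∑ W ∈ Finset.univ.powersetCard (s - j), Ψ ⟨j, (J, W)⟩ := by
        rw [Finset.sum_sigma]
        apply Finset.sum_congr rfl
        intro j _
        rw [Finset.sum_product]
    _ ≤ ∑ j ∈ Finset.range (s+1), ∑ J ∈ Z.powersetCard j,
          2 ^ (2 * D) * (2 ^ (D * j) * (G ^ (s - j) / (s - j).factorial)) := by
        apply Finset.sum_le_sum
        intro j hj
        apply Finset.sum_le_sum
        intro J hJ
        obtain ⟨hJZ, hJc⟩ := Finset.mem_powersetCard.1 hJ
        simp only [Ψ]
        rw [← Finset.mul_sum, ← Finset.mul_sum]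
        gcongr
        refine (esymm_bound (gw R D (J ∪ K0))
          (fun v => by have := one_le_gw R D (J ∪ K0) v; linarith) Finset.univ (s - j)).trans ?_
        gcongr
        · exact Finset.sum_nonneg
            (fun v _ => by have := one_le_gw R D (J ∪ K0) v; linarith)
        · rw [hG]
          apply sum_gw_le R D Mx (s+2) Z _ _ _ hM
          · exact Finset.union_subset hJZ Finset.inter_subset_right
          · have h1 := Finset.card_union_le J K0
            have h2 : K0.card ≤ 2 := (Finset.card_le_card Finset.inter_subset_left).trans
              Finset.card_le_two
            have h3 := Finset.mem_range.1 hj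
            omega
    _ ≤ 2 ^ (2 * D) * ∑ j ∈ Finset.range (s+1),
          ((2:ℝ) ^ D * Z.card) ^ j * G ^ (s - j) * (s.choose j) / s.factorial := by
        rw [Finset.mul_sum]
        apply Finset.sum_le_sum
        intro j hj
        have hjs : j ≤ s := Nat.lt_succ_iff.1 (Finset.mem_range.1 hj)
        rw [Finset.sum_const, Finset.card_powersetCard, nsmul_eq_mul]
        have h1 : ((Z.card.choose j : ℕ) : ℝ) ≤ (Z.card : ℝ) ^ j / j.factorial :=
          Nat.choose_le_pow_div j Z.card
        calc ((Z.card.choose j : ℕ) : ℝ)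
              * (2 ^ (2 * D) * (2 ^ (D * j) * (G ^ (s - j) / (s - j).factorial)))
            ≤ (Z.card : ℝ) ^ j / j.factorial
              * (2 ^ (2 * D) * (2 ^ (D * j) * (G ^ (s - j) / (s - j).factorial))) := by
              gcongr
          _ = _ := by
              rw [Nat.cast_choose ℝ hjs, mul_pow, ← pow_mul]
              have := Nat.factorial_pos s
              field_simp
    _ = _ := by
        rw [← Finset.sum_div, ← add_pow, add_comm]

open Classical in
lemma two_pow_loss_le {V : Type*} (R : V → V → Prop) (D : ℕ) (Z T : Finset V)
    (hD : ∀ v, (Z.filter (fun z => R v z)).card ≤ D) :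
    (2:ℝ) ^ ((T ×ˢ (T ∩ Z)).filter (fun p => R p.1 p.2 ∧ p.1 ≠ p.2)).card
      ≤ ∏ v ∈ T, gw R D (T ∩ Z) v := by
  have h1 : ((T ×ˢ (T ∩ Z)).filter (fun p => R p.1 p.2 ∧ p.1 ≠ p.2)).card
      ≤ ∑ v ∈ T, ((T ∩ Z).filter (fun z => R v z)).card := by
    rw [← Finset.card_sigma]
    apply Finset.card_le_card_of_injOn (fun p => ⟨p.1, p.2⟩)
    · rintro ⟨u, v⟩ h
      simp only [Finset.coe_filter, Finset.mem_product, Set.mem_ofPred_eq] at h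
      simp only [Finset.mem_coe, Finset.mem_sigma, Finset.mem_filter]
      exact ⟨h.1.1, h.1.2, h.2.1⟩
    · rintro ⟨u, v⟩ _ ⟨u', v'⟩ _ h
      simpa using h
  refine (pow_le_pow_right₀ (by norm_num) h1).trans ?_
  rw [← Finset.prod_pow_eq_pow_sum]
  apply Finset.prod_le_prod
  · intros; positivity
  · intro v _
    unfold gw
    split_ifs with h
    · apply pow_le_pow_right₀ (by norm_num)
      refine le_trans (Finset.card_le_card ?_) (hD v)
      exact Finset.filter_subset_filter _ Finset.inter_subset_right
    · have : (T ∩ Z).filter (fun z => R v z) = ∅ := by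
        apply Finset.filter_false_of_mem
        intro z hz hR
        exact h ⟨z, hz, hR⟩
      simp [this]

open Classical in
lemma avoid {V : Type*} [Fintype V] (k s : ℕ) (hk1 : 1 ≤ k) (R : V → V → Prop)
    (hRs : ∀ u v, R u v → R v u) (D Mx : ℕ)
    (Z : Finset V) (H : Finset (Finset V)) (hk : ∀ h ∈ H, h.card = k)
    (huniq : ∀ u v, u ≠ v → ¬ (R u v ∧ (u ∈ Z ∨ v ∈ Z)) → ∀ h ∈ H, ∀ h' ∈ H,
      u ∈ h → v ∈ h → u ∈ h' → v ∈ h' → h = h')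
    (hD : ∀ v, (Z.filter (fun z => R v z)).card ≤ D)
    (hM : ∀ z ∈ Z, (Finset.univ.filter (fun v => R v z)).card ≤ Mx)
    (hnum : 2 * ((s+2:ℕ):ℝ)^2 * (k:ℝ)^2 * ((1/2:ℝ)^((s+2).choose 2) * (2 ^ (2 * D) *
      ((Fintype.card V + (s+2:ℕ) * Mx * 2 ^ D + 2 ^ D * Z.card : ℝ) ^ s / s.factorial))) ≤ 1/4) :
    ∃ col : Finset V → Bool, ∀ b : Bool,
      ¬ HasBergeCopy (⊤ : SimpleGraph (Fin (s+2))) H (fun h => col h = b) := by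
  let bad : V → V → Prop := fun u v => R u v ∧ (u ∈ Z ∨ v ∈ Z)
  let E : Finset V → Finset (Finset V) := fun T =>
    H.filter (fun h => ∃ u ∈ T, ∃ v ∈ T, u ≠ v ∧ ¬ bad u v ∧ u ∈ h ∧ v ∈ h)
  let L : Finset V → ℕ := fun T =>
    ((T ×ˢ (T ∩ Z)).filter (fun p => R p.1 p.2 ∧ p.1 ≠ p.2)).card
  let I0 : Finset (Finset V) := (Finset.univ.powersetCard (s+2)).filter
    (fun T => (s+2).choose 2 ≤ (E T).card + L T)
  let w : Finset V → ℝ := fun T => (1/2:ℝ)^((s+2).choose 2) * ∏ v ∈ T, gw R D (T ∩ Z) v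
  have hw0 : ∀ T, 0 ≤ w T := by
    intro T
    have : 0 ≤ ∏ v ∈ T, gw R D (T ∩ Z) v :=
      Finset.prod_nonneg (fun v _ => by have := one_le_gw R D (T ∩ Z) v; linarith)
    simp only [w]; positivity
  have hEw : ∀ T ∈ I0, (1/2:ℝ)^(E T).card ≤ w T := by
    intro T hT
    have h1 := (Finset.mem_filter.1 hT).2
    have h2 := two_pow_loss_le R D Z T hD
    calc (1/2:ℝ)^(E T).card = (1/2:ℝ)^((E T).card + L T) * 2 ^ (L T) := by
          rw [pow_add, mul_assoc, ← mul_pow]; norm_num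
      _ ≤ (1/2:ℝ)^((s+2).choose 2) * 2 ^ (L T) := by
          apply mul_le_mul_of_nonneg_right _ (by positivity)
          exact pow_le_pow_of_le_one (by norm_num) (by norm_num) h1
      _ ≤ _ := by
          simp only [w]
          apply mul_le_mul_of_nonneg_left h2 (by positivity)
  set X : ℝ := (1/2:ℝ)^((s+2).choose 2) * (2 ^ (2 * D) *
      ((Fintype.card V + (s+2:ℕ) * Mx * 2 ^ D + 2 ^ D * Z.card : ℝ) ^ s / s.factorial)) with hX
  have hX0 : 0 ≤ X := by positivity
  have hsumX : ∀ a b, a ≠ b → ∑ T ∈ I0.filter (fun T => a ∈ T ∧ b ∈ T), w T ≤ X := by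
    intro a b hab
    refine le_trans ?_ (mul_le_mul_of_nonneg_left (sum_sets R D Mx s Z hM a b hab)
      (by positivity))
    rw [Finset.mul_sum]
    apply Finset.sum_le_sum_of_subset_of_nonneg
    · exact Finset.filter_subset_filter _ (Finset.filter_subset _ _)
    · intro T _ _; exact hw0 T
  have hX4 : X ≤ 1/4 := by
    have h1 : (1:ℝ) ≤ 2 * ((s+2:ℕ):ℝ)^2 * (k:ℝ)^2 := by
      have h1 : 1 ≤ 2 * (s+2)^2 * k^2 := Nat.succ_le_of_lt (by positivity)
      exact_mod_cast h1
    nlinarith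
  have hI0c : ∀ T ∈ I0, T.card = s + 2 := by
    intro T hT
    exact (Finset.mem_powersetCard.1 (Finset.mem_filter.1 hT).1).2
  have hne : ∀ T ∈ I0, (E T).Nonempty := by
    intro T hT
    obtain ⟨a, ha, b, hb, hab⟩ := Finset.one_lt_card.1
      (by rw [hI0c T hT]; omega : 1 < T.card)
    have h1 : w T ≤ X := by
      refine le_trans ?_ (hsumX a b hab)
      exact Finset.single_le_sum (f := w) (fun T _ => hw0 T)
        (Finset.mem_filter.2 ⟨hT, ha, hb⟩)
    rw [← Finset.card_pos]
    by_contra h0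
    have h0 : (E T).card = 0 := by omega
    have := hEw T hT
    rw [h0, pow_zero] at this
    linarith
  -- neighbourhoods
  have hnb : ∀ S ∈ I0, ∑ T ∈ I0 with ¬ Disjoint (E T) (E S), w T
      ≤ ((s+2:ℕ):ℝ)^2 * (k:ℝ)^2 * X := by
    intro S hS
    have hsub : I0.filter (fun T => ¬ Disjoint (E T) (E S)) ⊆
        (E S).biUnion (fun h => h.offDiag.biUnion
          (fun p => I0.filter (fun T => p.1 ∈ T ∧ p.2 ∈ T))) := by
      intro T hT
      obtain ⟨hTI, hd⟩ := Finset.mem_filter.1 hT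
      rw [Finset.not_disjoint_iff] at hd
      obtain ⟨h, hhT, hhS⟩ := hd
      obtain ⟨hH, u, hu, v, hv, huv, hb, huh, hvh⟩ := Finset.mem_filter.1 hhT
      simp only [Finset.mem_biUnion]
      exact ⟨h, hhS, (u, v), Finset.mem_offDiag.2 ⟨huh, hvh, huv⟩,
        Finset.mem_filter.2 ⟨hTI, hu, hv⟩⟩
    have hEc : (E S).card ≤ (s+2)^2 := by
      have h1 : E S ⊆ (S ×ˢ S).image (fun p =>
          if hp : ∃ h ∈ H, p.1 ∈ h ∧ p.2 ∈ h then hp.choose else ∅) := by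
        intro h hh
        obtain ⟨hH, u, hu, v, hv, huv, hb, huh, hvh⟩ := Finset.mem_filter.1 hh
        refine Finset.mem_image.2 ⟨(u, v), Finset.mem_product.2 ⟨hu, hv⟩, ?_⟩
        have hp : ∃ h ∈ H, (u, v).1 ∈ h ∧ (u, v).2 ∈ h := ⟨h, hH, huh, hvh⟩
        rw [dif_pos hp]
        have hs := hp.choose_spec
        exact huniq u v huv hb _ hs.1 _ hH hs.2.1 hs.2.2 huh hvh
      refine (Finset.card_le_card h1).trans (Finset.card_image_le.trans ?_)
      rw [Finset.card_product, hI0c S hS, sq]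
    have hbu : ∀ {β : Type _} (A : Finset β) (f : β → Finset (Finset V)),
        ∑ T ∈ A.biUnion f, w T ≤ ∑ x ∈ A, ∑ T ∈ f x, w T := by
      intro β A f
      induction A using Finset.induction_on with
      | empty => simp
      | insert a A ha ih =>
        rw [Finset.biUnion_insert, Finset.sum_insert ha]
        have := Finset.sum_union_inter (s₁ := f a) (s₂ := A.biUnion f) (f := w)
        have h2 : 0 ≤ ∑ T ∈ f a ∩ A.biUnion f, w T := Finset.sum_nonneg (fun T _ => hw0 T)
        linarith
    calc ∑ T ∈ I0 with ¬ Disjoint (E T) (E S), w T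
        ≤ ∑ T ∈ (E S).biUnion (fun h => h.offDiag.biUnion
          (fun p => I0.filter (fun T => p.1 ∈ T ∧ p.2 ∈ T))), w T :=
          Finset.sum_le_sum_of_subset_of_nonneg hsub (fun T _ _ => hw0 T)
      _ ≤ ∑ h ∈ E S, ∑ p ∈ h.offDiag, ∑ T ∈ I0.filter (fun T => p.1 ∈ T ∧ p.2 ∈ T), w T := by
          refine (hbu _ _).trans ?_
          apply Finset.sum_le_sum
          intro h _
          exact hbu _ _
      _ ≤ ∑ h ∈ E S, ∑ p ∈ h.offDiag, X := by
          apply Finset.sum_le_sum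
          intro h _
          apply Finset.sum_le_sum
          intro p hp
          exact hsumX _ _ (Finset.mem_offDiag.1 hp).2.2
      _ ≤ ∑ h ∈ E S, (k:ℝ)^2 * X := by
          apply Finset.sum_le_sum
          intro h hh
          rw [Finset.sum_const, nsmul_eq_mul]
          apply mul_le_mul_of_nonneg_right _ hX0
          have : h.offDiag.card ≤ k^2 := by
            rw [Finset.offDiag_card, hk h (Finset.mem_filter.1 hh).1, sq]
            exact Nat.sub_le _ _
          exact_mod_cast this
      _ ≤ _ := by
          rw [Finset.sum_const, nsmul_eq_mul, mul_assoc]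
          apply mul_le_mul_of_nonneg_right _ (by positivity)
          exact_mod_cast hEc
  obtain ⟨c, hc⟩ := lll (I0 ×ˢ (Finset.univ : Finset Bool)) (fun p => E p.1) (fun p => p.2)
    (fun p hp => hne p.1 (Finset.mem_product.1 hp).1) (by
      intro p hp
      have hS := (Finset.mem_product.1 hp).1
      have h1 : (I0 ×ˢ (Finset.univ : Finset Bool)).filter
          (fun q => ¬ Disjoint (E q.1) (E p.1)) =
          (I0.filter (fun T => ¬ Disjoint (E T) (E p.1))) ×ˢ (Finset.univ : Finset Bool) := by
        ext q
        simp only [Finset.mem_filter, Finset.mem_product, Finset.mem_univ, and_true]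
      rw [h1, Finset.sum_product]
      simp only [Finset.sum_const, Finset.card_univ, Fintype.card_bool, nsmul_eq_mul]
      rw [← Finset.mul_sum]
      have h2 : ∑ T ∈ I0 with ¬ Disjoint (E T) (E p.1), (1/2:ℝ)^(E T).card
          ≤ ∑ T ∈ I0 with ¬ Disjoint (E T) (E p.1), w T := by
        apply Finset.sum_le_sum
        intro T hT
        exact hEw T (Finset.mem_filter.1 hT).1
      have h3 := hnb p.1 hS
      push_cast
      push_cast at hnum h3
      linarith)
  refine ⟨c, ?_⟩
  rintro b ⟨y, f, hy, hf, hyf⟩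
  have hedge : ∀ i j : Fin (s+2), i ≠ j → s(i, j) ∈ (⊤ : SimpleGraph (Fin (s+2))).edgeSet := by
    intro i j hij
    simpa using hij
  set T : Finset V := Finset.univ.image y with hT
  have hTc : T.card = s + 2 := by
    rw [hT, Finset.card_image_of_injective _ hy]; simp
  have hyT : ∀ i, y i ∈ T := fun i => Finset.mem_image_of_mem _ (Finset.mem_univ _)
  have hTI : T ∈ I0 := by
    refine Finset.mem_filter.2 ⟨Finset.mem_powersetCard.2 ⟨Finset.subset_univ _, hTc⟩, ?_⟩
    let P : Finset (Fin (s+2) × Fin (s+2)) := Finset.univ.filter (fun p => p.1 < p.2)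
    have hP : P.card = (s+2).choose 2 := by
      have h1 : P.card = ∑ j : Fin (s+2), (Finset.Iio j).card := by
        rw [← Finset.card_sigma]
        apply Finset.card_bij (fun p _ => ⟨p.2, p.1⟩)
        · rintro ⟨i, j⟩ hp
          simpa [P] using hp
        · rintro ⟨i, j⟩ _ ⟨i', j'⟩ _ h
          simp only [Sigma.mk.injEq, heq_eq_eq] at h
          rw [h.1, h.2]
        · rintro ⟨j, i⟩ h
          exact ⟨(i, j), by simpa [P] using h, rfl⟩
      rw [h1]
      simp only [Fin.card_Iio]
      rw [Fin.sum_univ_eq_sum_range (fun i => i), Finset.sum_range_id, Nat.choose_two_right]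
    have hg : (P.filter (fun p => ¬ bad (y p.1) (y p.2))).card ≤ (E T).card := by
      apply Finset.card_le_card_of_injOn (fun p => f s(p.1, p.2))
      · rintro ⟨i, j⟩ hp
        simp only [P, Finset.coe_filter, Finset.mem_filter, Finset.mem_univ, true_and,
          Set.mem_ofPred_eq] at hp
        have h1 := hyf _ (hedge i j hp.1.ne)
        refine Finset.mem_coe.2 (Finset.mem_filter.2 ⟨h1.1, y i, hyT i, y j, hyT j,
          fun h => hp.1.ne (hy h), hp.2, ?_, ?_⟩)
        · exact h1.2.2 i (by simp)
        · exact h1.2.2 j (by simp)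
      · rintro ⟨i, j⟩ hp ⟨i', j'⟩ hp' h
        simp only [P, Finset.coe_filter, Finset.mem_filter, Finset.mem_univ, true_and,
          Set.mem_ofPred_eq] at hp hp'
        have h1 := hf (hedge i j hp.1.ne) (hedge i' j' hp'.1.ne) h
        rcases Sym2.eq_iff.1 h1 with ⟨rfl, rfl⟩ | ⟨rfl, rfl⟩
        · rfl
        · exact absurd hp.1 (not_lt.2 hp'.1.le)
    have hb : (P.filter (fun p => bad (y p.1) (y p.2))).card ≤ L T := by
      apply Finset.card_le_card_of_injOn
        (fun p => if y p.2 ∈ Z then (y p.1, y p.2) else (y p.2, y p.1))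
      · rintro ⟨i, j⟩ hp
        simp only [P, Finset.coe_filter, Finset.mem_filter, Finset.mem_univ, true_and,
          Set.mem_ofPred_eq] at hp
        have hne : y i ≠ y j := fun h => hp.1.ne (hy h)
        refine Finset.mem_coe.2 (Finset.mem_filter.2 ?_)
        by_cases hz : y j ∈ Z
        · simp only [hz, if_true]
          exact ⟨Finset.mem_product.2 ⟨hyT i, Finset.mem_inter.2 ⟨hyT j, hz⟩⟩, hp.2.1, hne⟩
        · simp only [hz, if_false]
          exact ⟨Finset.mem_product.2 ⟨hyT j, Finset.mem_inter.2
            ⟨hyT i, hp.2.2.resolve_right hz⟩⟩, hRs _ _ hp.2.1, hne.symm⟩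
      · rintro ⟨i, j⟩ hp ⟨i', j'⟩ hp' h
        simp only [P, Finset.coe_filter, Finset.mem_filter, Finset.mem_univ, true_and,
          Set.mem_ofPred_eq] at hp hp'
        have a1 := hp.1
        have a2 := hp'.1
        simp only at h
        split_ifs at h <;> simp only [Prod.mk.injEq] at h <;>
          have e1 := hy h.1 <;> have e2 := hy h.2 <;> subst e1 <;> subst e2
        · rfl
        · exact absurd a1 (not_lt.2 a2.le)
        · exact absurd a1 (not_lt.2 a2.le)
        · rfl
    have := Finset.card_filter_add_card_filter_not (s := P) (fun p => bad (y p.1) (y p.2))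
    omega
  obtain ⟨h, hh, hcb⟩ := hc (T, b) (Finset.mem_product.2 ⟨hTI, Finset.mem_univ _⟩)
  apply hcb
  obtain ⟨hH, u, hu, v, hv, huv, hb, huh, hvh⟩ := Finset.mem_filter.1 hh
  obtain ⟨i, _, rfl⟩ := Finset.mem_image.1 hu
  obtain ⟨j, _, rfl⟩ := Finset.mem_image.1 hv
  have hij : i ≠ j := fun h => huv (by rw [h])
  have h1 := hyf _ (hedge i j hij)
  have : h = f s(i, j) := huniq _ _ huv hb _ hH _ h1.1 huh hvh
    (h1.2.2 i (by simp)) (h1.2.2 j (by simp))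
  rw [this]
  exact h1.2.1

lemma exists_cross {F : Type*} [Field F] [Fintype F] [DecidableEq F] (k : ℕ)
    (hF : k + 4 ≤ Fintype.card F) (ρ : F) (h0 : ρ ≠ 0) (h1 : ρ ≠ 1) (i j : Fin k) (hij : i ≠ j) :
    ∃ γ : Fin 4 → Fin k → F, (∀ c, Function.Injective (γ c)) ∧
      ∀ a b, a ≠ b → (γ 0 b - γ 0 a) * (γ 3 b - γ 3 a) / ((γ 1 b - γ 1 a) * (γ 2 b - γ 2 a)) =
        if (a = i ∧ b = j) ∨ (a = j ∧ b = i) then ρ else 1 := by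
  obtain ⟨x, hx⟩ : ∃ x : F, x ∉ ({0, 1, 1/(1-ρ)} : Finset F) := by
    by_contra! h
    have : (Finset.univ : Finset F) ⊆ {0, 1, 1/(1-ρ)} := fun y _ => h y
    have h2 := (Finset.card_le_card this).trans Finset.card_le_three
    rw [Finset.card_univ] at h2
    have := i.pos
    omega
  simp only [Finset.mem_insert, Finset.mem_singleton, not_or] at hx
  obtain ⟨hx0, hx1, hx2⟩ := hx
  have h1ρ : 1 - ρ ≠ 0 := sub_ne_zero.2 (Ne.symm h1)
  have hden : ρ * x - x + 1 ≠ 0 := by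
    intro h
    apply hx2
    rw [eq_div_iff h1ρ]
    linear_combination -h
  set A : F := ρ * x / (ρ * x - x + 1) with hA
  have hAe : A * (ρ * x - x + 1) = ρ * x := by rw [hA]; exact div_mul_cancel₀ _ hden
  have hA0 : A ≠ 0 := by rw [hA]; exact div_ne_zero (mul_ne_zero h0 hx0) hden
  have hA1 : A ≠ 1 := by
    intro h
    rw [h] at hAe
    apply hx1
    linear_combination -hAe
  obtain ⟨r, hr, hrn⟩ : ∃ r : Fin k → F, Function.Injective r ∧
      ∀ a, r a ∉ ({A, x, 0, 1} : Finset F) := by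
    have hc : k ≤ (Finset.univ \ ({A, x, 0, 1} : Finset F)).card := by
      have := Finset.le_card_sdiff ({A, x, 0, 1} : Finset F) Finset.univ
      have h4 : ({A, x, 0, 1} : Finset F).card ≤ 4 := Finset.card_le_four
      rw [Finset.card_univ] at this
      omega
    obtain ⟨S, hS, hSc⟩ := Finset.exists_subset_card_eq hc
    let e := S.equivFinOfCardEq hSc
    refine ⟨fun a => (e.symm a : F), ?_, ?_⟩
    · intro a b h
      exact e.symm.injective (Subtype.ext h)
    · intro a
      exact (Finset.mem_sdiff.1 (hS (e.symm a).2)).2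
  simp only [Finset.mem_insert, Finset.mem_singleton, not_or] at hrn
  have inj : ∀ P S : F, P ≠ S → (∀ a, r a ≠ P) → (∀ a, r a ≠ S) →
      Function.Injective (fun a => if a = i then P else if a = j then S else r a) := by
    intro P S hPS hP hS a b h
    simp only at h
    split_ifs at h with q1 q2 q3 q4 q5 q6 q7 q8
    all_goals first
      | (subst_vars; rfl)
      | exact absurd h hPS
      | exact absurd h hPS.symm
      | exact absurd h (hP _)
      | exact absurd h (hS _)
      | exact absurd h.symm (hP _)
      | exact absurd h.symm (hS _)
      | exact hr h
  refine ⟨![fun a => if a = i then A else if a = j then 0 else r a,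
    fun a => if a = i then x else if a = j then 0 else r a,
    fun a => if a = i then A else if a = j then 1 else r a,
    fun a => if a = i then x else if a = j then 1 else r a], ?_, ?_⟩
  · intro c
    fin_cases c
    · exact inj A 0 hA0 (fun a => (hrn a).1) (fun a => (hrn a).2.2.1)
    · exact inj x 0 hx0 (fun a => (hrn a).2.1) (fun a => (hrn a).2.2.1)
    · exact inj A 1 hA1 (fun a => (hrn a).1) (fun a => (hrn a).2.2.2)
    · exact inj x 1 hx1 (fun a => (hrn a).2.1) (fun a => (hrn a).2.2.2)
  · intro a b hab
    have r1 : ∀ a, r a - A ≠ 0 := fun a => sub_ne_zero.2 (hrn a).1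
    have r2 : ∀ a, r a - x ≠ 0 := fun a => sub_ne_zero.2 (hrn a).2.1
    have r3 : ∀ a, r a - 0 ≠ 0 := fun a => sub_ne_zero.2 (hrn a).2.2.1
    have r4 : ∀ a, r a - 1 ≠ 0 := fun a => sub_ne_zero.2 (hrn a).2.2.2
    have r1' : ∀ a, A - r a ≠ 0 := fun a => sub_ne_zero.2 (Ne.symm (hrn a).1)
    have r2' : ∀ a, x - r a ≠ 0 := fun a => sub_ne_zero.2 (Ne.symm (hrn a).2.1)
    have r3' : ∀ a, 0 - r a ≠ 0 := fun a => sub_ne_zero.2 (Ne.symm (hrn a).2.2.1)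
    have r4' : ∀ a, 1 - r a ≠ 0 := fun a => sub_ne_zero.2 (Ne.symm (hrn a).2.2.2)
    have s1 : (1:F) - A ≠ 0 := sub_ne_zero.2 (Ne.symm hA1)
    have s2 : A - 1 ≠ 0 := sub_ne_zero.2 hA1
    have key1 : (0 - A) * (1 - x) / ((0 - x) * (1 - A)) = ρ := by
      rw [div_eq_iff (mul_ne_zero (sub_ne_zero.2 (Ne.symm hx0)) s1)]
      linear_combination -hAe
    have key2 : (A - 0) * (x - 1) / ((x - 0) * (A - 1)) = ρ := by
      rw [div_eq_iff (mul_ne_zero (sub_ne_zero.2 hx0) s2)]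
      linear_combination -hAe
    simp only [Matrix.cons_val]
    have hji := hij.symm
    by_cases ai : a = i
    · subst ai
      have hba : b ≠ a := Ne.symm hab
      by_cases bj : b = j
      · subst bj
        simp only [hji, if_true, if_false, true_or, and_self]
        exact key1
      · simp only [hba, bj, hij, if_true, if_false, and_false, or_false]
        rw [mul_comm (r b - A)]
        exact div_self (mul_ne_zero (r2 b) (r1 b))
    · by_cases aj : a = j
      · subst aj
        have hba : b ≠ a := Ne.symm hab
        by_cases bi : b = i
        · subst bi
          simp only [hji, if_true, if_false, and_self, or_true]
          exact key2
        · simp only [hba, bi, ai, if_true, if_false, and_false, or_false]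
          exact div_self (mul_ne_zero (r3 b) (r4 b))
      · simp only [ai, aj, if_false, false_and, or_false]
        by_cases bi : b = i
        · subst bi
          simp only [if_true]
          rw [mul_comm (A - r a)]
          exact div_self (mul_ne_zero (r2' a) (r1' a))
        · by_cases bj : b = j
          · subst bj
            simp only [if_true, bi, if_false]
            exact div_self (mul_ne_zero (r3' a) (r4' a))
          · simp only [bi, bj, if_false]
            have := sub_ne_zero.2 (fun h => hab (hr h).symm : r b ≠ r a)
            exact div_self (mul_ne_zero this this)

/-- The coordinate set. -/
abbrev Cd (k : ℕ) : Type := Option ({p : Fin k × Fin k // p.1 < p.2} × Fin 4)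

lemma card_lt_pairs (k : ℕ) : 2 * Fintype.card {p : Fin k × Fin k // p.1 < p.2} = k * (k - 1) := by
  rw [Fintype.card_subtype]
  have h1 : (Finset.univ.filter (fun p : Fin k × Fin k => p.1 < p.2)).card
      = ∑ j : Fin k, (Finset.Iio j).card := by
    rw [← Finset.card_sigma]
    apply Finset.card_bij (fun p _ => ⟨p.2, p.1⟩)
    · rintro ⟨i, j⟩ hp
      simpa using hp
    · rintro ⟨i, j⟩ _ ⟨i', j'⟩ _ h
      simp only [Sigma.mk.injEq, heq_eq_eq] at h
      rw [h.1, h.2]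
    · rintro ⟨j, i⟩ h
      exact ⟨(i, j), by simpa using h, rfl⟩
  rw [h1]
  simp only [Fin.card_Iio]
  rw [Fin.sum_univ_eq_sum_range (fun i => i), mul_comm, Finset.sum_range_id_mul_two]

lemma exists_base {F : Type*} [Field F] [Fintype F] [DecidableEq F] (k M : ℕ) (hk : 2 ≤ k)
    (hF : k + 4 ≤ Fintype.card F) (hM : Fintype.card F = k * (k - 1) * M + 1) (hM2 : 2 ≤ M)
    (hMo : Odd M) :
    ∃ (β : Cd k → Fin k → F) (n : Cd k → ℤ), (∀ c, Function.Injective (β c)) ∧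
      (∀ d : Cd k → F, (∀ c, d c ≠ 0) → (∏ c, d c ^ n c) ^ (k * (k - 1)) = 1) ∧
      (∀ i j i' j' : Fin k, i ≠ j → i' ≠ j' →
        ∏ c, (β c j - β c i) ^ n c = ∏ c, (β c j' - β c i') ^ n c → i = i' ∧ j = j') := by
  set N := k * (k - 1) with hN
  have hN2 : 2 ≤ N := by
    obtain ⟨l, rfl⟩ : ∃ l, k = l + 2 := ⟨k - 2, by omega⟩
    rw [hN]; simp; nlinarith
  have hPc := card_lt_pairs k
  rw [← hN] at hPc
  let PP := {p : Fin k × Fin k // p.1 < p.2}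
  let τ : PP ≃ Fin (Fintype.card PP) := Fintype.equivFin _
  obtain ⟨g, hg⟩ := IsCyclic.exists_generator (α := Fˣ)
  have hord : orderOf g = N * M := by
    rw [orderOf_eq_card_of_forall_mem_zpowers hg, Nat.card_eq_fintype_card, Fintype.card_units, hM]
    simp
  have hpow : ∀ a b : ℕ, a < N * M → b < N * M → (g:F) ^ a = (g:F) ^ b → a = b := by
    intro a b ha hb h
    rw [← hord] at ha hb
    apply pow_injOn_Iio_orderOf ha hb
    ext
    simpa using h
  have hm1 : (-1 : F) ≠ 1 := by
    intro h
    have h2 : ringChar F = 2 := by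
      by_contra hne
      exact Ring.neg_one_ne_one_of_char_ne_two hne h
    have := FiniteField.even_card_of_char_two h2
    rw [hM] at this
    rw [← hPc, mul_assoc] at this
    omega
  -- base coordinate
  obtain ⟨x, hx⟩ : ∃ x : Fin k → F, Function.Injective x := by
    have : Nonempty (Fin k ↪ F) := by
      apply Function.Embedding.nonempty_of_card_le
      simp; omega
    obtain ⟨e⟩ := this
    exact ⟨e, e.injective⟩
  have hxs : ∀ i j, i ≠ j → x j - x i ≠ 0 := fun i j h => sub_ne_zero.2 (fun h' => h (hx h').symm)
  have hρ : ∀ p : PP, ∃ ρ : F, ρ ≠ 0 ∧ ρ ≠ 1 ∧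
      ρ ^ M * (x p.1.2 - x p.1.1) ^ M = (g:F) ^ (M * (τ p : ℕ)) := by
    intro p
    have hd := hxs _ _ p.2.ne
    have hgN : (g:F) ^ (N * M) = 1 := by
      rw [← hord, ← Units.val_pow_eq_pow_val, pow_orderOf_eq_one]; rfl
    have hgt : ∀ a : ℕ, (g:F) ^ a ≠ 0 := fun a => pow_ne_zero _ g.ne_zero
    by_cases h : (g:F) ^ (τ p : ℕ) / (x p.1.2 - x p.1.1) = 1
    · refine ⟨(g:F) ^ ((τ p : ℕ) + N) / (x p.1.2 - x p.1.1), div_ne_zero (hgt _) hd, ?_, ?_⟩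
      · rw [pow_add, mul_div_right_comm, h, one_mul]
        intro hh
        have := hpow N 0 (by nlinarith) (by positivity) (by simpa using hh)
        omega
      · rw [← mul_pow, div_mul_cancel₀ _ hd, pow_add, mul_pow, ← pow_mul, ← pow_mul, hgN, mul_one,
          mul_comm M]
    · refine ⟨(g:F) ^ (τ p : ℕ) / (x p.1.2 - x p.1.1), div_ne_zero (hgt _) hd, h, ?_⟩
      rw [← mul_pow, div_mul_cancel₀ _ hd, ← pow_mul, mul_comm M]
  choose ρ hρ0 hρ1 hρM using hρ
  choose γ hγi hγ using fun p : PP => exists_cross k hF (ρ p) (hρ0 p) (hρ1 p) p.1.1 p.1.2 p.2.ne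
  let sg : Fin 4 → ℤ := ![1, -1, -1, 1]
  let β : Cd k → Fin k → F := fun c => match c with
    | none => x
    | some (p, c) => γ p c
  let n : Cd k → ℤ := fun c => match c with
    | none => M
    | some (_, c) => sg c * M
  have hphi : ∀ i j, i ≠ j → ∏ c, (β c j - β c i) ^ n c =
      (x j - x i) ^ M * ∏ p : PP, (if (i = p.1.1 ∧ j = p.1.2) ∨ (i = p.1.2 ∧ j = p.1.1)
        then ρ p else 1) ^ M := by
    intro i j hij
    rw [Fintype.prod_option]
    congr 1
    · simp [β, n]
    · rw [Fintype.prod_prod_type]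
      apply Finset.prod_congr rfl
      intro p _
      rw [← hγ p i j hij, Fin.prod_univ_four]
      simp only [β, n, sg, Matrix.cons_val]
      rw [zpow_mul, zpow_mul, zpow_mul, zpow_mul]
      simp only [zpow_one, zpow_neg, zpow_natCast, inv_pow, div_pow, mul_pow]
      rw [div_eq_mul_inv, mul_inv]
      ring
  have hlt : ∀ p : PP, ∏ c, (β c p.1.2 - β c p.1.1) ^ n c = (g:F) ^ (M * (τ p : ℕ)) := by
    intro p
    rw [hphi _ _ p.2.ne, Finset.prod_eq_single p]
    · rw [← hρM p]; simp [mul_comm]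
    · intro q _ hq
      rw [if_neg, one_pow]
      rintro (⟨h1, h2⟩ | ⟨h1, h2⟩)
      · exact hq (Subtype.ext (Prod.ext h1.symm h2.symm))
      · have a := p.2
        rw [h1, h2] at a
        exact absurd a (not_lt.2 q.2.le)
    · simp
  have hgt : ∀ p : PP, ∏ c, (β c p.1.1 - β c p.1.2) ^ n c = - (g:F) ^ (M * (τ p : ℕ)) := by
    intro p
    rw [← hlt p, hphi _ _ p.2.ne, hphi _ _ p.2.ne']
    rw [← neg_sub, hMo.neg_pow, neg_mul]
    congr 2
    apply Finset.prod_congr rfl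
    intro q _
    congr 1
    apply if_congr _ rfl rfl
    tauto
  have hτ : ∀ p : PP, 2 * (M * (τ p : ℕ)) < N * M := by
    intro p
    have := (τ p).2
    have hPc' : 2 * Fintype.card PP = N := hPc
    have h2 : 2 * (τ p : ℕ) < N := by omega
    nlinarith
  have hsame : ∀ p q : PP, (g:F) ^ (M * (τ p : ℕ)) = (g:F) ^ (M * (τ q : ℕ)) → p = q := by
    intro p q h
    have h1 := hpow _ _ (by have := hτ p; omega) (by have := hτ q; omega) h
    have h2 : (τ p : ℕ) = τ q := Nat.eq_of_mul_eq_mul_left (by omega) h1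
    exact τ.injective (Fin.ext h2)
  have hdiff : ∀ p q : PP, (g:F) ^ (M * (τ p : ℕ)) ≠ - (g:F) ^ (M * (τ q : ℕ)) := by
    intro p q h
    have h1 : (g:F) ^ (2 * (M * (τ p : ℕ))) = (g:F) ^ (2 * (M * (τ q : ℕ))) := by
      rw [mul_comm 2 (M * (τ p : ℕ)), pow_mul, h, neg_sq, ← pow_mul, mul_comm 2]
    have h2 := hpow _ _ (hτ p) (hτ q) h1
    have h3 : M * (τ p : ℕ) = M * (τ q : ℕ) := by omega
    rw [h3] at h
    have h4 : (g:F) ^ (M * (τ q : ℕ)) ≠ 0 := pow_ne_zero _ g.ne_zero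
    apply hm1
    apply mul_left_cancel₀ h4
    linear_combination -h
  refine ⟨β, n, ?_, ?_, ?_⟩
  · rintro (_ | ⟨p, c⟩)
    · exact hx
    · exact hγi p c
  · intro d hd
    rw [← Finset.prod_pow]
    apply Finset.prod_eq_one
    intro c _
    have h1 : d c ^ (M * N) = 1 := by
      have := FiniteField.pow_card_sub_one_eq_one (d c) (hd c)
      rw [hM] at this
      simpa [mul_comm] using this
    have h2 : (d c ^ (M:ℤ)) ^ N = 1 := by
      rw [zpow_natCast, ← pow_mul, h1]
    rcases c with _ | ⟨p, c⟩
    · exact h2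
    · change (d _ ^ (sg c * M)) ^ N = 1
      rw [mul_comm, zpow_mul, ← zpow_natCast, ← zpow_mul, mul_comm, zpow_mul, zpow_natCast, h2,
        one_zpow]
  · intro i j i' j' hij hij' h
    rcases lt_or_gt_of_ne hij with l | l <;> rcases lt_or_gt_of_ne hij' with l' | l'
    · have e1 := hlt ⟨(i, j), l⟩
      have e2 := hlt ⟨(i', j'), l'⟩
      simp only at e1 e2
      rw [e1, e2] at h
      have h5 := congrArg Subtype.val (hsame _ _ h)
      exact ⟨congrArg Prod.fst h5, congrArg Prod.snd h5⟩
    · have e1 := hlt ⟨(i, j), l⟩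
      have e2 := hgt ⟨(j', i'), l'⟩
      simp only at e1 e2
      rw [e1, e2] at h
      exact absurd h (hdiff _ _)
    · have e1 := hgt ⟨(j, i), l⟩
      have e2 := hlt ⟨(i', j'), l'⟩
      simp only at e1 e2
      rw [e1, e2] at h
      exact absurd h.symm (hdiff _ _)
    · have e1 := hgt ⟨(j, i), l⟩
      have e2 := hgt ⟨(j', i'), l'⟩
      simp only at e1 e2
      rw [e1, e2, neg_inj] at h
      have h5 := congrArg Subtype.val (hsame _ _ h)
      exact ⟨congrArg Prod.snd h5, congrArg Prod.fst h5⟩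

lemma exists_base_surj {F : Type*} [Field F] [Fintype F] [DecidableEq F] (k : ℕ) (hk : 2 ≤ k)
    (β : Cd k → Fin k → F) (n : Cd k → ℤ)
    (h2 : ∀ d : Cd k → F, (∀ c, d c ≠ 0) → (∏ c, d c ^ n c) ^ (k * (k - 1)) = 1)
    (h1 : ∀ c, Function.Injective (β c))
    (h3 : ∀ i j i' j' : Fin k, i ≠ j → i' ≠ j' →
        ∏ c, (β c j - β c i) ^ n c = ∏ c, (β c j' - β c i') ^ n c → i = i' ∧ j = j')
    (d : Cd k → F) (hd : ∀ c, d c ≠ 0) :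
    ∃ i j, i ≠ j ∧ ∏ c, (β c j - β c i) ^ n c = ∏ c, d c ^ n c := by
  have hN : 0 < k * (k - 1) := Nat.mul_pos (by omega) (by omega)
  let S : Finset F := ((Finset.univ : Finset (Fin k)).offDiag).image
    (fun p => ∏ c, (β c p.2 - β c p.1) ^ n c)
  have hS : S.card = k * (k - 1) := by
    rw [Finset.card_image_of_injOn]
    · rw [Finset.offDiag_card]; simp [Nat.mul_sub]
    · rintro ⟨i, j⟩ hp ⟨i', j'⟩ hp' h
      simp only [Finset.mem_coe, Finset.mem_offDiag, Finset.mem_univ, true_and] at hp hp'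
      obtain ⟨a, b⟩ := h3 _ _ _ _ hp hp' h
      rw [a, b]
  have hsub : S ⊆ Polynomial.nthRootsFinset (k * (k - 1)) (1:F) := by
    intro y hy
    obtain ⟨⟨i, j⟩, hp, rfl⟩ := Finset.mem_image.1 hy
    simp only [Finset.mem_offDiag, Finset.mem_univ, true_and] at hp
    rw [Polynomial.mem_nthRootsFinset hN]
    apply h2
    intro c
    exact sub_ne_zero.2 (fun h => hp (h1 c h).symm)
  have heq : S = Polynomial.nthRootsFinset (k * (k - 1)) (1:F) := by
    apply Finset.eq_of_subset_of_card_le hsub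
    rw [hS, Polynomial.nthRootsFinset_def]
    exact (Multiset.toFinset_card_le _).trans (Polynomial.card_nthRoots _ _)
  have : ∏ c, d c ^ n c ∈ S := by
    rw [heq, Polynomial.mem_nthRootsFinset hN]
    exact h2 d hd
  obtain ⟨⟨i, j⟩, hp, h⟩ := Finset.mem_image.1 this
  simp only [Finset.mem_offDiag, Finset.mem_univ, true_and] at hp
  exact ⟨i, j, hp, h⟩

lemma isUnit_sub_fin (k m : ℕ) (hm : ∀ d : ℕ, 0 < d → d < k → Nat.Coprime d m) (i j : Fin k)
    (hij : i ≠ j) : IsUnit (((j : ℕ) : ZMod m) - ((i : ℕ) : ZMod m)) := by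
  have key : ∀ a b : Fin k, a < b → IsUnit (((b : ℕ) : ZMod m) - ((a : ℕ) : ZMod m)) := by
    intro a b hab
    have h : (a : ℕ) < b := hab
    have h2 := hm ((b : ℕ) - a) (by omega) (by have := b.2; omega)
    rw [← Nat.cast_sub h.le]
    exact (ZMod.isUnit_iff_coprime _ _).2 h2
  rcases lt_or_gt_of_ne hij with h | h
  · exact key _ _ h
  · have := (key _ _ h).neg
    rwa [neg_sub] at this

open Classical in
lemma design {F : Type*} [Field F] [Fintype F] (k M m : ℕ) [NeZero m] (hk : 2 ≤ k)
    (hF : k + 4 ≤ Fintype.card F) (hM : Fintype.card F = k * (k - 1) * M + 1) (hM2 : 2 ≤ M)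
    (hMo : Odd M) (hm : ∀ d : ℕ, 0 < d → d < k → Nat.Coprime d m) (hmk : k ≤ m) :
    ∃ (H : Finset (Finset ((Cd k → F) × ZMod m))) (Z : Finset ((Cd k → F) × ZMod m)),
      (∀ h ∈ H, h.card = k) ∧
      (∀ u v : (Cd k → F) × ZMod m, u ≠ v → ∃ h ∈ H, u ∈ h ∧ v ∈ h) ∧
      (∀ u v : (Cd k → F) × ZMod m, u ≠ v → ¬ ((∃ c, u.1 c = v.1 c) ∧ (u ∈ Z ∨ v ∈ Z)) →
        ∀ h ∈ H, ∀ h' ∈ H, u ∈ h → v ∈ h → u ∈ h' → v ∈ h' → h = h') ∧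
      (∀ v : (Cd k → F) × ZMod m, (Z.filter (fun z => ∃ c, v.1 c = z.1 c)).card ≤ Fintype.card (Cd k) * k) ∧
      (∀ z ∈ Z, (Finset.univ.filter (fun v : (Cd k → F) × ZMod m => ∃ c, v.1 c = z.1 c)).card ≤
        Fintype.card (Cd k) * (Fintype.card F ^ (Fintype.card (Cd k) - 1) * m)) ∧
      Z.card ≤ Fintype.card F * k := by
  obtain ⟨β, n, hβ, hβ2, hβ3⟩ := exists_base (F := F) k M hk hF hM hM2 hMo
  have hsurj := exists_base_surj k hk β n hβ2 hβ hβ3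
  let V := (Cd k → F) × ZMod m
  let pt : (Cd k → F) → (Cd k → F) → ZMod m → ZMod m → Fin k → V :=
    fun ω b z σ i => (fun c => ω c * β c i + b c, z + ((i : ℕ) : ZMod m) * σ)
  let blk : (Cd k → F) → (Cd k → F) → ZMod m → ZMod m → Finset V :=
    fun ω b z σ => Finset.univ.image (pt ω b z σ)
  let R : V → V → Prop := fun u v => ∃ c, u.1 c = v.1 c
  let zp : F × Fin k → V := fun p => (fun _ => p.1, ((p.2 : ℕ) : ZMod m))
  let Z : Finset V := Finset.univ.image zp
  let G : Finset V → Finset V → Prop := fun s h => h.card = k ∧ s ⊆ h ∧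
    (∃ c x, ∀ w ∈ h, w.1 c = x) ∧ h \ s ⊆ Z
  have hGex : ∀ u v : V, u ≠ v → R u v → ∃ h, G {u, v} h := by
    rintro u v huv ⟨c, hc⟩
    let Zx : Finset V := Finset.univ.image (fun i : Fin k => zp (u.1 c, i))
    have hZx : Zx.card = k := by
      rw [Finset.card_image_of_injective, Finset.card_univ, Fintype.card_fin]
      intro i j h
      have h2 : ((i : ℕ) : ZMod m) = ((j : ℕ) : ZMod m) := congrArg Prod.snd h
      have h3 := congrArg ZMod.val h2
      rw [ZMod.val_natCast_of_lt (by have := i.2; omega),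
        ZMod.val_natCast_of_lt (by have := j.2; omega)] at h3
      exact Fin.ext h3
    obtain ⟨h, h1, h2, h3⟩ := Finset.exists_subsuperset_card_eq (n := k)
      (Finset.subset_union_right : ({u, v} : Finset V) ⊆ Zx ∪ {u, v})
      (by rw [Finset.card_pair huv]; exact hk)
      (hZx.ge.trans (Finset.card_le_card Finset.subset_union_left))
    refine ⟨h, h3, h1, ⟨c, u.1 c, ?_⟩, ?_⟩
    · intro w hw
      rcases Finset.mem_union.1 (h2 hw) with hw | hw
      · obtain ⟨i, _, rfl⟩ := Finset.mem_image.1 hw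
        rfl
      · rcases Finset.mem_insert.1 hw with rfl | hw
        · rfl
        · rw [Finset.mem_singleton.1 hw, hc]
    · intro w hw
      rw [Finset.mem_sdiff] at hw
      rcases Finset.mem_union.1 (h2 hw.1) with hw' | hw'
      · obtain ⟨i, _, rfl⟩ := Finset.mem_image.1 hw'
        exact Finset.mem_image_of_mem _ (Finset.mem_univ _)
      · exact absurd hw' hw.2
  choose! g hg using fun (s : Finset V) (hs : ∃ h, G s h) => hs
  have hgG : ∀ u v : V, u ≠ v → R u v → G {u, v} (g {u, v}) := fun u v h1 h2 =>
    hg _ (hGex u v h1 h2)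
  let P1 : Finset V → Prop := fun h => ∃ ω b z σ, (∀ c, ω c ≠ 0) ∧ ∏ c, ω c ^ n c = 1 ∧
    h = blk ω b z σ
  let P2 : Finset V → Prop := fun h => ∃ u v, u ≠ v ∧ R u v ∧ h = g {u, v}
  have hP1R : ∀ h, P1 h → ∀ u ∈ h, ∀ v ∈ h, u ≠ v → ¬ R u v := by
    rintro h ⟨ω, b, z, σ, hω, _, rfl⟩ u hu v hv huv ⟨c, hc⟩
    obtain ⟨i, _, rfl⟩ := Finset.mem_image.1 hu
    obtain ⟨j, _, rfl⟩ := Finset.mem_image.1 hv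
    apply huv
    have h1 : ω c * β c i + b c = ω c * β c j + b c := hc
    rw [add_left_inj] at h1
    rw [hβ c (mul_left_cancel₀ (hω c) h1)]
  have hP2R : ∀ h, P2 h → ∀ u ∈ h, ∀ v ∈ h, R u v := by
    rintro h ⟨a, b, hab, hR, rfl⟩ u hu v hv
    obtain ⟨_, _, ⟨c, x, hx⟩, _⟩ := hgG a b hab hR
    exact ⟨c, (hx u hu).trans (hx v hv).symm⟩
  have hP1u : ∀ u v, u ≠ v → ¬ R u v → ∀ h h', P1 h → P1 h' → u ∈ h → v ∈ h → u ∈ h' → v ∈ h' →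
      h = h' := by
    rintro u v huv hR h h' ⟨ω, b, z, σ, hω, hω1, rfl⟩ ⟨ω', b', z', σ', hω', hω1', rfl⟩ hu hv hu' hv'
    obtain ⟨i, _, hi⟩ := Finset.mem_image.1 hu
    obtain ⟨j, _, hj⟩ := Finset.mem_image.1 hv
    obtain ⟨i', _, hi'⟩ := Finset.mem_image.1 hu'
    obtain ⟨j', _, hj'⟩ := Finset.mem_image.1 hv'
    have hij : i ≠ j := by rintro rfl; exact huv (hi.symm.trans hj)
    have hij' : i' ≠ j' := by rintro rfl; exact huv (hi'.symm.trans hj')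
    have ei : ∀ c, ω c * β c i + b c = u.1 c := fun c => congrFun (congrArg Prod.fst hi) c
    have ej : ∀ c, ω c * β c j + b c = v.1 c := fun c => congrFun (congrArg Prod.fst hj) c
    have ei' : ∀ c, ω' c * β c i' + b' c = u.1 c := fun c => congrFun (congrArg Prod.fst hi') c
    have ej' : ∀ c, ω' c * β c j' + b' c = v.1 c := fun c => congrFun (congrArg Prod.fst hj') c
    have si : z + ((i : ℕ) : ZMod m) * σ = u.2 := congrArg Prod.snd hi
    have sj : z + ((j : ℕ) : ZMod m) * σ = v.2 := congrArg Prod.snd hj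
    have si' : z' + ((i' : ℕ) : ZMod m) * σ' = u.2 := congrArg Prod.snd hi'
    have sj' : z' + ((j' : ℕ) : ZMod m) * σ' = v.2 := congrArg Prod.snd hj'
    have d1 : ∀ c, v.1 c - u.1 c = ω c * (β c j - β c i) := by
      intro c; rw [← ei, ← ej]; ring
    have d2 : ∀ c, v.1 c - u.1 c = ω' c * (β c j' - β c i') := by
      intro c; rw [← ei', ← ej']; ring
    have p1 : ∏ c, (v.1 c - u.1 c) ^ n c = ∏ c, (β c j - β c i) ^ n c := by
      simp only [d1, mul_zpow, Finset.prod_mul_distrib, hω1, one_mul]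
    have p2 : ∏ c, (v.1 c - u.1 c) ^ n c = ∏ c, (β c j' - β c i') ^ n c := by
      simp only [d2, mul_zpow, Finset.prod_mul_distrib, hω1', one_mul]
    obtain ⟨rfl, rfl⟩ := hβ3 i j i' j' hij hij' (p1.symm.trans p2)
    have hωω : ω = ω' := by
      funext c
      apply mul_right_cancel₀ (sub_ne_zero.2 (fun h => hij (hβ c h).symm) : β c j - β c i ≠ 0)
      rw [← d1, ← d2]
    subst hωω
    have hbb : b = b' := by
      funext c
      have := (ei c).trans (ei' c).symm
      exact add_left_cancel this
    subst hbb
    have hσσ : σ = σ' := by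
      apply (isUnit_sub_fin k m hm i j hij).mul_left_cancel
      linear_combination sj - si - sj' + si'
    subst hσσ
    have hzz : z = z' := add_right_cancel (si.trans si'.symm)
    subst hzz
    rfl
  have hP2u : ∀ u v, u ≠ v → u ∉ Z → v ∉ Z → ∀ h, P2 h → u ∈ h → v ∈ h → h = g {u, v} := by
    rintro u v huv huZ hvZ h ⟨a, b, hab, hR, rfl⟩ hu hv
    obtain ⟨_, _, _, hs⟩ := hgG a b hab hR
    have h1 : ∀ w, w ∈ g {a, b} → w ∉ Z → w ∈ ({a, b} : Finset V) := by
      intro w hw hwZ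
      by_contra hn
      exact hwZ (hs (Finset.mem_sdiff.2 ⟨hw, hn⟩))
    have h2 : ({u, v} : Finset V) = {a, b} := by
      apply Finset.eq_of_subset_of_card_le
      · intro w hw
        rcases Finset.mem_insert.1 hw with rfl | hw
        · exact h1 _ hu huZ
        · rw [Finset.mem_singleton.1 hw]; exact h1 _ hv hvZ
      · rw [Finset.card_pair huv, Finset.card_pair hab]
    rw [h2]
  refine ⟨Finset.univ.filter (fun h => P1 h ∨ P2 h), Z, ?_, ?_, ?_, ?_, ?_, ?_⟩
  · intro h hh
    rcases (Finset.mem_filter.1 hh).2 with ⟨ω, b, z, σ, hω, _, rfl⟩ | ⟨u, v, huv, hR, rfl⟩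
    · rw [Finset.card_image_of_injective, Finset.card_univ, Fintype.card_fin]
      intro i j hij
      have h1 : ω none * β none i + b none = ω none * β none j + b none :=
        congrFun (congrArg Prod.fst hij) none
      rw [add_left_inj] at h1
      exact hβ none (mul_left_cancel₀ (hω none) h1)
    · exact (hgG u v huv hR).1
  · intro u v huv
    by_cases hR : R u v
    · refine ⟨g {u, v}, Finset.mem_filter.2 ⟨Finset.mem_univ _, Or.inr ⟨u, v, huv, hR, rfl⟩⟩, ?_⟩
      have hs := (hgG u v huv hR).2.1
      exact ⟨hs (by simp), hs (by simp)⟩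
    · have hd : ∀ c, v.1 c - u.1 c ≠ 0 := fun c h => hR ⟨c, (sub_eq_zero.1 h).symm⟩
      obtain ⟨i, j, hij, hp⟩ := hsurj (fun c => v.1 c - u.1 c) hd
      have hb : ∀ c, β c j - β c i ≠ 0 := fun c => sub_ne_zero.2 (fun h => hij (hβ c h).symm)
      obtain ⟨y, hy⟩ := isUnit_sub_fin k m hm i j hij
      let ω : Cd k → F := fun c => (v.1 c - u.1 c) / (β c j - β c i)
      let σ : ZMod m := (y⁻¹ : (ZMod m)ˣ) * (v.2 - u.2)
      have hσ : (((j : ℕ) : ZMod m) - ((i : ℕ) : ZMod m)) * σ = v.2 - u.2 := by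
        rw [← hy]; exact Units.mul_inv_cancel_left y _
      have hω : ∀ c, ω c * (β c j - β c i) = v.1 c - u.1 c := fun c => div_mul_cancel₀ _ (hb c)
      refine ⟨blk ω (fun c => u.1 c - ω c * β c i) (u.2 - ((i : ℕ) : ZMod m) * σ) σ,
        Finset.mem_filter.2 ⟨Finset.mem_univ _, Or.inl ⟨ω, _, _, σ, ?_, ?_, rfl⟩⟩, ?_, ?_⟩
      · exact fun c => div_ne_zero (hd c) (hb c)
      · simp only [ω, div_zpow, Finset.prod_div_distrib]
        rw [hp]
        apply div_self
        exact Finset.prod_ne_zero_iff.2 (fun c _ => zpow_ne_zero _ (hd c))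
      · refine Finset.mem_image.2 ⟨i, Finset.mem_univ _, ?_⟩
        refine Prod.ext ?_ ?_
        · funext c
          simp only [pt]; ring
        · simp only [pt]; ring
      · refine Finset.mem_image.2 ⟨j, Finset.mem_univ _, ?_⟩
        refine Prod.ext ?_ ?_
        · funext c
          simp only [pt]
          linear_combination hω c
        · simp only [pt]
          linear_combination hσ
  · intro u v huv hn h hh h' hh' hu hv hu' hv'
    have hh := (Finset.mem_filter.1 hh).2
    have hh' := (Finset.mem_filter.1 hh').2
    by_cases hR : R u v
    · have hZ : u ∉ Z ∧ v ∉ Z := by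
        constructor
        · exact fun h => hn ⟨hR, Or.inl h⟩
        · exact fun h => hn ⟨hR, Or.inr h⟩
      have h2 := hh.resolve_left (fun h1 => hP1R h h1 u hu v hv huv hR)
      have h2' := hh'.resolve_left (fun h1 => hP1R h' h1 u hu' v hv' huv hR)
      rw [hP2u u v huv hZ.1 hZ.2 h h2 hu hv, hP2u u v huv hZ.1 hZ.2 h' h2' hu' hv']
    · have h1 := hh.resolve_right (fun h2 => hR (hP2R h h2 u hu v hv))
      have h1' := hh'.resolve_right (fun h2 => hR (hP2R h' h2 u hu' v hv'))
      exact hP1u u v huv hR h h' h1 h1' hu hv hu' hv'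
  · intro v
    have hsub : Z.filter (fun z => ∃ c, v.1 c = z.1 c) ⊆
        (Finset.univ : Finset (Cd k × Fin k)).image (fun p => zp (v.1 p.1, p.2)) := by
      intro w hw
      obtain ⟨hw, c, hc⟩ := Finset.mem_filter.1 hw
      obtain ⟨⟨x, i⟩, _, rfl⟩ := Finset.mem_image.1 hw
      refine Finset.mem_image.2 ⟨(c, i), Finset.mem_univ _, ?_⟩
      have : v.1 c = x := hc
      simp only [this]
    refine (Finset.card_le_card hsub).trans (Finset.card_image_le.trans ?_)
    rw [Finset.card_univ, Fintype.card_prod, Fintype.card_fin]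
  · intro z _
    have hsub : (Finset.univ.filter (fun v : (Cd k → F) × ZMod m => ∃ c, v.1 c = z.1 c)) ⊆
        (Finset.univ : Finset (Cd k)).biUnion (fun c =>
          (Fintype.piFinset (fun c' => if c' = c then {z.1 c} else Finset.univ)) ×ˢ
            (Finset.univ : Finset (ZMod m))) := by
      intro v hv
      obtain ⟨_, c, hc⟩ := Finset.mem_filter.1 hv
      refine Finset.mem_biUnion.2 ⟨c, Finset.mem_univ _, Finset.mem_product.2 ⟨?_, Finset.mem_univ _⟩⟩
      rw [Fintype.mem_piFinset]
      intro c'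
      split_ifs with h
      · rw [h, hc]; simp
      · exact Finset.mem_univ _
    refine (Finset.card_le_card hsub).trans ?_
    have := Finset.card_biUnion_le_card_mul (Finset.univ : Finset (Cd k)) (fun c =>
          (Fintype.piFinset (fun c' => if c' = c then {z.1 c} else Finset.univ)) ×ˢ
            (Finset.univ : Finset (ZMod m))) (Fintype.card F ^ (Fintype.card (Cd k) - 1) * m) ?_
    · rwa [Finset.card_univ] at this
    · intro c _
      rw [Finset.card_product, Finset.card_univ, ZMod.card, Fintype.card_piFinset]
      apply Nat.mul_le_mul_right
      rw [← Finset.mul_prod_erase _ _ (Finset.mem_univ c), if_pos rfl, Finset.card_singleton, one_mul]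
      apply le_of_eq
      rw [Finset.prod_congr rfl (g := fun _ => Fintype.card F), Finset.prod_const,
        Finset.card_erase_of_mem (Finset.mem_univ _), Finset.card_univ]
      intro x hx
      rw [if_neg (Finset.ne_of_mem_erase hx), Finset.card_univ]
  · refine Finset.card_image_le.trans ?_
    rw [Finset.card_univ, Fintype.card_prod, Fintype.card_fin]

open Classical in
lemma finite_bound (k s M m p d : ℕ) [Fact p.Prime] (hd : d ≠ 0) (hk : 2 ≤ k)
    (hF : k + 4 ≤ p ^ d) (hM : p ^ d = k * (k - 1) * M + 1) (hM2 : 2 ≤ M)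
    (hMo : Odd M) (hm : ∀ d : ℕ, 0 < d → d < k → Nat.Coprime d m) (hmk : k ≤ m)
    (E D : ℕ) (hE : E = Fintype.card (Cd k)) (hD : D = E * k)
    (hnum : 2 * ((s+2:ℕ):ℝ)^2 * (k:ℝ)^2 * ((1/2:ℝ)^((s+2).choose 2) * (2 ^ (2 * D) *
      ((((p ^ d) ^ E * m : ℕ) + (s+2:ℕ) * (E * ((p ^ d) ^ (E - 1) * m) : ℕ) * 2 ^ D
        + 2 ^ D * (p ^ d * k : ℕ) : ℝ) ^ s / s.factorial))) ≤ 1/4) :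
    ∃ (H : Finset (Finset (Fin ((p ^ d) ^ E * m)))) (col : Finset (Fin ((p ^ d) ^ E * m)) → Bool),
      (∀ h ∈ H, h.card = k) ∧
      (∀ u v, u ≠ v → ∃ h ∈ H, u ∈ h ∧ v ∈ h) ∧
      ∀ b : Bool, ¬ HasBergeCopy (⊤ : SimpleGraph (Fin (s+2))) H (fun h => col h = b) := by
  have : NeZero m := ⟨by omega⟩
  let F := GaloisField p d
  have : Fintype F := Fintype.ofFinite F
  have hcF : Fintype.card F = p ^ d := by
    rw [← Nat.card_eq_fintype_card]; exact GaloisField.card p d hd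
  obtain ⟨H, Z, h1, h2, h3, h4, h5, h6⟩ := design (F := F) k M m hk (by rw [hcF]; exact hF)
    (by rw [hcF]; exact hM) hM2 hMo hm hmk
  have hcV : Fintype.card ((Cd k → F) × ZMod m) = (p ^ d) ^ E * m := by
    rw [Fintype.card_prod, ZMod.card, Fintype.card_fun, hcF, hE]
  rw [hcF, ← hE] at h5
  rw [hcF] at h6
  rw [← hE, ← hD] at h4
  obtain ⟨col, hcol⟩ := avoid k s (by omega) (fun u v : (Cd k → F) × ZMod m => ∃ c, u.1 c = v.1 c)
    (fun u v ⟨c, hc⟩ => ⟨c, hc.symm⟩) D (E * ((p ^ d) ^ (E - 1) * m)) Z H h1 h3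
    (by intro v; convert h4 v) (by intro z hz; convert h5 z hz) (by
      refine le_trans ?_ hnum
      rw [hcV]
      have : (Z.card : ℝ) ≤ (p ^ d * k : ℕ) := by exact_mod_cast h6
      gcongr)
  let φ : (Cd k → F) × ZMod m ≃ Fin ((p ^ d) ^ E * m) := Fintype.equivFinOfCardEq hcV
  refine ⟨H.map φ.finsetCongr.toEmbedding, fun h => col (φ.finsetCongr.symm h), ?_, ?_, ?_⟩
  · intro h hh
    obtain ⟨h', hh', rfl⟩ := Finset.mem_map.1 hh
    simpa using h1 h' hh'
  · intro u v huv
    obtain ⟨h, hh, hu, hv⟩ := h2 (φ.symm u) (φ.symm v) (fun h => huv (φ.symm.injective h))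
    refine ⟨φ.finsetCongr h, Finset.mem_map.2 ⟨h, hh, rfl⟩, ?_, ?_⟩
    · simpa using hu
    · simpa using hv
  · rintro b ⟨y, f, hy, hf, hall⟩
    apply hcol b
    refine ⟨fun a => φ.symm (y a), fun e => φ.finsetCongr.symm (f e), φ.symm.injective.comp hy,
      ?_, ?_⟩
    · intro e1 he1 e2 he2 h
      exact hf he1 he2 (φ.finsetCongr.symm.injective h)
    · intro e he
      obtain ⟨a1, a2, a3⟩ := hall e he
      refine ⟨?_, a2, ?_⟩
      · obtain ⟨h', hh', h⟩ := Finset.mem_map.1 a1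
        beta_reduce
        rw [← h]
        change φ.finsetCongr.symm (φ.finsetCongr h') ∈ H
        rwa [Equiv.symm_apply_apply]
      · intro v hv
        have := a3 v hv
        simpa using this

lemma num_key (s : ℕ) : (1/2:ℝ)^((s+2).choose 2) *
    (Real.sqrt 2 / Real.exp 1 * ((s+2:ℕ):ℝ) * Real.sqrt 2 ^ (s+2)) ^ s / s.factorial
      ≤ Real.exp 1 ^ 2 / 2 := by
  have h1 := Real.pow_div_factorial_le_exp ((s+2:ℕ):ℝ) (by positivity) s
  have hr : Real.sqrt 2 ^ 2 = 2 := Real.sq_sqrt (by norm_num)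
  have hr0 : Real.sqrt 2 ≠ 0 := by positivity
  have h2 : (1/2:ℝ)^((s+2).choose 2) * (Real.sqrt 2 * Real.sqrt 2 ^ (s+2)) ^ s = 1/2 := by
    have e1 : (s+2).choose 2 * 2 = (s+2) * (s+1) := by
      rw [Nat.choose_two_right]
      have : 2 ∣ (s+2) * (s+2-1) := (Nat.even_mul_pred_self (s+2)).two_dvd
      rw [Nat.div_mul_cancel this]; rfl
    have e2 : (1/2:ℝ)^((s+2).choose 2) = 1 / Real.sqrt 2 ^ ((s+2) * (s+1)) := by
      rw [← e1, mul_comm, pow_mul, hr, one_div_pow]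
    rw [e2, ← pow_succ', ← pow_mul]
    have e3 : (s+2) * (s+1) = (s+2+1) * s + 2 := by ring
    rw [e3, pow_add, hr]
    field_simp
  have h3 : Real.exp ((s+2:ℕ):ℝ) = Real.exp 1 ^ s * Real.exp 1 ^ 2 := by
    rw [← pow_add, ← Real.exp_nat_mul, mul_one]
  rw [h3] at h1
  have he : (0:ℝ) < Real.exp 1 ^ s := by positivity
  calc (1/2:ℝ)^((s+2).choose 2) *
        (Real.sqrt 2 / Real.exp 1 * ((s+2:ℕ):ℝ) * Real.sqrt 2 ^ (s+2)) ^ s / s.factorial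
      = ((1/2:ℝ)^((s+2).choose 2) * (Real.sqrt 2 * Real.sqrt 2 ^ (s+2)) ^ s) *
        ((((s+2:ℕ):ℝ)^s / s.factorial) / Real.exp 1 ^ s) := by
        rw [mul_pow, mul_pow, mul_pow, div_pow]; ring
    _ ≤ 1/2 * ((Real.exp 1 ^ s * Real.exp 1 ^ 2) / Real.exp 1 ^ s) := by
        rw [h2]; gcongr
    _ = Real.exp 1 ^ 2 / 2 := by
        field_simp

lemma ev_poly (c : ℝ) (a : ℕ) (δ : ℝ) (hδ : 0 < δ) : ∀ᶠ t : ℕ in Filter.atTop,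
    c * (t:ℝ)^a ≤ δ * (Real.sqrt 2 / Real.exp 1 * (t:ℝ) * Real.sqrt 2 ^ t) := by
  have hs : (1:ℝ) < Real.sqrt 2 := by
    rw [Real.lt_sqrt (by norm_num)]; norm_num
  have h := (tendsto_pow_const_div_const_pow_of_one_lt a hs).const_mul (|c|)
  rw [mul_zero] at h
  have hpos : 0 < δ * (Real.sqrt 2 / Real.exp 1) := by positivity
  filter_upwards [h.eventually (gt_mem_nhds hpos), Filter.eventually_ge_atTop 1] with t ht h1
  have h1' : (1:ℝ) ≤ t := by exact_mod_cast h1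
  rw [← mul_div_assoc, div_lt_iff₀ (by positivity)] at ht
  calc c * (t:ℝ)^a ≤ |c| * (t:ℝ)^a := by gcongr; exact le_abs_self c
    _ ≤ δ * (Real.sqrt 2 / Real.exp 1) * Real.sqrt 2 ^ t := ht.le
    _ ≤ δ * (Real.sqrt 2 / Real.exp 1) * Real.sqrt 2 ^ t * t := le_mul_of_one_le_right (by positivity) h1'
    _ = _ := by ring

lemma exists_good_prime (k : ℕ) (hk : 2 ≤ k) : ∃ p : ℕ, p.Prime ∧ ∀ d, Odd d →
    k * (k - 1) + 1 < p ^ d → ∃ M, 2 ≤ M ∧ Odd M ∧ p ^ d = k * (k - 1) * M + 1 := by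
  set N := k * (k - 1) with hN
  have hN2 : 0 < N := Nat.mul_pos (by omega) (by omega)
  obtain ⟨l, hl⟩ : 2 ∣ N := (Nat.even_mul_pred_self k).two_dvd
  have hcop : Nat.Coprime (1 + N) (2 * N) := by
    apply Nat.Coprime.mul_right
    · rw [hl]; simp
    · simp
  have : NeZero (2 * N) := ⟨by omega⟩
  obtain ⟨p, _, hp, hpm⟩ := Nat.forall_exists_prime_gt_and_eq_mod (q := 2 * N)
    ((ZMod.isUnit_iff_coprime _ _).2 hcop) 0
  refine ⟨p, hp, ?_⟩
  rintro d ⟨b, rfl⟩ hlt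
  have hz : (2 * N : ZMod (2 * N)) = 0 := by
    have := ZMod.natCast_self (2 * N)
    push_cast at this; exact this
  have h1 : ((p ^ (2 * b + 1) : ℕ) : ZMod (2 * N)) = ((1 + N : ℕ) : ZMod (2 * N)) := by
    rw [Nat.cast_pow, hpm, pow_add, pow_mul, pow_one]
    have : (((1 + N : ℕ) : ZMod (2 * N))) ^ 2 = 1 := by
      have hNl : (N : ZMod (2 * N)) = 2 * l := by
        have := congrArg (Nat.cast : ℕ → ZMod (2 * N)) hl
        push_cast at this; exact this
      push_cast
      calc (1 + (N : ZMod (2 * N))) ^ 2 = 1 + 2 * N + N * N := by ring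
        _ = 1 + 2 * N + N * (2 * l) := by rw [← hNl]
        _ = 1 + 2 * N + (2 * N) * l := by ring
        _ = 1 := by rw [hz]; ring
    rw [this, one_pow, one_mul]
  rw [ZMod.natCast_eq_natCast_iff] at h1
  obtain ⟨y, hy⟩ := (Nat.modEq_iff_dvd' (by omega)).1 h1.symm
  have hy0 : y ≠ 0 := by
    rintro rfl; omega
  refine ⟨2 * y + 1, by omega, ⟨y, rfl⟩, ?_⟩
  have : p ^ (2 * b + 1) = 1 + N + 2 * N * y := by omega
  rw [this]; ring

set_option maxHeartbeats 2000000 in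
/-- Exponential lower bound for the cover Ramsey number of Berge cliques: for every
`k ≥ 2` and `ε ∈ (0,1)` there is `t₀` such that for every `t ≥ t₀` there exist
`n ≥ (1-ε)·(√2/e)·t·2^(t/2)`, a covering `k`-uniform hypergraph on `n` vertices and a
2-coloring of its edges with no monochromatic Berge copy of `K_t`. -/
theorem cover_ramsey_clique_exponential_lower
    (k : ℕ) (hk : 2 ≤ k) (ε : ℝ) (hε : 0 < ε) (hε1 : ε < 1) :
    ∃ t₀ : ℕ, ∀ t : ℕ, t₀ ≤ t →
      ∃ n : ℕ,
        (1 - ε) * (Real.sqrt 2 / Real.exp 1) * (t : ℝ) * (2 : ℝ) ^ ((t : ℝ) / 2) ≤ (n : ℝ) ∧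
        ∃ (H : Finset (Finset (Fin n))) (col : Finset (Fin n) → Bool),
          (∀ h ∈ H, h.card = k) ∧
          (∀ u v : Fin n, u ≠ v → ∃ h ∈ H, u ∈ h ∧ v ∈ h) ∧
          ∀ b : Bool, ¬ HasBergeCopy (⊤ : SimpleGraph (Fin t)) H (fun h => col h = b) := by
  obtain ⟨p, hp, hpd⟩ := exists_good_prime k hk
  have : Fact p.Prime := ⟨hp⟩
  obtain ⟨E, hE⟩ : ∃ E, E = Fintype.card (Cd k) := ⟨_, rfl⟩
  have hE1 : 1 ≤ E := by rw [hE]; exact Fintype.card_pos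
  obtain ⟨D, hD⟩ : ∃ D, D = E * k := ⟨_, rfl⟩
  set N := k * (k - 1) with hN
  obtain ⟨L, hL⟩ : ∃ L, L = k.factorial := ⟨_, rfl⟩
  have hL0 : 1 ≤ L := by rw [hL]; exact Nat.factorial_pos k
  obtain ⟨C1, hC1⟩ := exists_nat_ge (8 * E * 2 ^ D / ε)
  have hC1' : (8 * E * 2 ^ D : ℝ) ≤ C1 * ε := (div_le_iff₀ hε).1 hC1
  have hC10 : 1 ≤ C1 := by
    rcases Nat.eq_zero_or_pos C1 with h | h
    · rw [h] at hC1'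
      have : (0:ℝ) < 8 * E * 2 ^ D := by positivity
      simp at hC1'
      linarith
    · exact h
  set θ : ℝ := 1 - ε / 4 with hθ
  have hθ0 : 0 < θ := by rw [hθ]; linarith
  have hθ1 : θ < 1 := by rw [hθ]; linarith
  have hk0 : 0 < k := by omega
  have hkR : (0:ℝ) < k := by exact_mod_cast hk0
  have ev4 := (tendsto_pow_const_mul_const_pow_of_abs_lt_one 2
    (r := θ) (by rw [abs_of_pos hθ0]; exact hθ1)).eventually
    (gt_mem_nhds (show (0:ℝ) < θ ^ 2 / (4 * k ^ 2 * 2 ^ (2 * D) * Real.exp 1 ^ 2) by positivity))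
  have ev1 := ev_poly ((p ^ 2 * C1 : ℝ) ^ E * (L + 1)) E (ε / 2) (by linarith)
  have ev2 := ev_poly (k * L * (p ^ 2 * C1 : ℝ) ^ E) E (1 - ε) (by linarith)
  have ev3 := ev_poly (2 ^ D * (p ^ 2 * C1) * k : ℝ) 1 (ε / 8) (by linarith)
  obtain ⟨t₀, ht₀⟩ := Filter.eventually_atTop.1 (ev1.and (ev2.and (ev3.and ev4)))
  refine ⟨max t₀ (k + 4 + N + 2), fun t ht => ?_⟩
  obtain ⟨e1, e2, e3, e4⟩ := ht₀ t (le_trans (le_max_left _ _) ht)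
  have htk : k + 4 + N + 2 ≤ t := le_trans (le_max_right _ _) ht
  clear ev1 ev2 ev3 ev4 ht₀ ht
  set X : ℝ := Real.sqrt 2 / Real.exp 1 * (t:ℝ) * Real.sqrt 2 ^ t with hX
  have hX' : (1 - ε) * (Real.sqrt 2 / Real.exp 1) * (t : ℝ) * (2 : ℝ) ^ ((t : ℝ) / 2)
      = (1 - ε) * X := by
    have h : (2 : ℝ) ^ ((t : ℝ) / 2) = Real.sqrt 2 ^ t := by
      rw [Real.sqrt_eq_rpow, ← Real.rpow_natCast, ← Real.rpow_mul (by norm_num)]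
      congr 1; ring
    rw [h, hX]; ring
  rw [hX']
  have htR : (0:ℝ) < t := by
    have : 0 < t := by omega
    exact_mod_cast this
  have hX0 : 0 < X := by rw [hX]; positivity
  -- choice of the field size
  obtain ⟨d, hdo, hd1, hd2⟩ : ∃ d, Odd d ∧ C1 * t < p ^ d ∧ p ^ d ≤ p ^ 2 * (C1 * t) := by
    have hne : C1 * t ≠ 0 := Nat.mul_ne_zero (by omega) (by omega)
    have a1 := Nat.pow_log_le_self p hne
    have a2 := Nat.lt_pow_succ_log_self hp.one_lt (C1 * t)
    set a := Nat.log p (C1 * t)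
    rcases Nat.even_or_odd a with ha | ha
    · refine ⟨a + 1, ha.add_one, a2, ?_⟩
      rw [pow_succ, mul_comm]
      exact Nat.mul_le_mul (Nat.le_self_pow (by norm_num) p) a1
    · refine ⟨a + 2, by rw [Nat.odd_add]; simp [ha], a2.trans_le ?_, ?_⟩
      · exact Nat.pow_le_pow_right hp.pos (by omega)
      · rw [pow_add, mul_comm]
        exact Nat.mul_le_mul_left _ a1
  have htC : t ≤ C1 * t := Nat.le_mul_of_pos_left t (by omega)
  obtain ⟨M, hM2, hMo, hM⟩ := hpd d hdo (by omega)
  obtain ⟨Q, hQ⟩ : ∃ Q, Q = p ^ d := ⟨_, rfl⟩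
  have hd1R : (C1:ℝ) * t < Q := by rw [hQ]; exact_mod_cast hd1
  have hd2R : (Q:ℝ) ≤ p ^ 2 * C1 * t := by
    rw [hQ, mul_assoc]; exact_mod_cast hd2
  have hQ0 : (0:ℝ) < Q := lt_trans (by positivity) hd1R
  have hQE : (Q:ℝ) ^ E ≤ (p ^ 2 * C1) ^ E * t ^ E := by
    rw [← mul_pow]; gcongr
  have hLR : (1:ℝ) ≤ L := by exact_mod_cast hL0
  -- choice of m
  set j := ⌈(1 - ε) * X / (Q ^ E * L)⌉₊ with hj
  have hj1 : (1 - ε) * X / (Q ^ E * L) ≤ j := Nat.le_ceil _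
  have hj2 : (j:ℝ) < (1 - ε) * X / (Q ^ E * L) + 1 :=
    Nat.ceil_lt_add_one (div_nonneg (mul_nonneg (by linarith) hX0.le) (by positivity))
  have hQL : (0:ℝ) < Q ^ E * L := by positivity
  rw [div_le_iff₀ hQL] at hj1
  rw [← sub_lt_iff_lt_add, lt_div_iff₀ hQL] at hj2
  have hkj : k ≤ j := by
    have h1 : (k:ℝ) * (Q ^ E * L) ≤ (1 - ε) * X := by
      refine le_trans ?_ e2
      calc (k:ℝ) * (Q ^ E * L) ≤ k * (((p ^ 2 * C1) ^ E * t ^ E) * L) := by gcongr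
        _ = _ := by ring
    have h2 : (k:ℝ) ≤ j := le_of_mul_le_mul_right (h1.trans hj1) hQL
    exact_mod_cast h2
  set m := L * j + 1 with hm
  have hmR : (m:ℝ) = L * j + 1 := by rw [hm]; push_cast; ring
  have hmk : k ≤ m := by
    have : j ≤ L * j := Nat.le_mul_of_pos_left j (by omega)
    omega
  have hmc : ∀ d : ℕ, 0 < d → d < k → Nat.Coprime d m := by
    intro b hb hbk
    have hdv : b ∣ L * j := Dvd.dvd.mul_right (by rw [hL]; exact Nat.dvd_factorial hb hbk.le) j
    obtain ⟨y, hy⟩ := hdv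
    rw [hm, hy]
    simp
  have hQE0 : (0:ℝ) < Q ^ E := by positivity
  have hnlow : (1 - ε) * X ≤ (Q:ℝ) ^ E * m := by
    rw [hmR]; nlinarith
  have hnup : (Q:ℝ) ^ E * m ≤ (1 - ε / 2) * X := by
    have h1 : (Q:ℝ) ^ E * (L + 1) ≤ ε / 2 * X := by
      refine le_trans ?_ e1
      calc (Q:ℝ) ^ E * (L + 1) ≤ ((p ^ 2 * C1) ^ E * t ^ E) * (L + 1) := by gcongr
        _ = _ := by ring
    rw [hmR]; nlinarith
  refine ⟨(p ^ d) ^ E * m, ?_, ?_⟩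
  · rw [← hQ]; push_cast; exact hnlow
  obtain ⟨s, rfl⟩ : ∃ s, t = s + 2 := ⟨t - 2, by omega⟩
  refine finite_bound k s M m p d hdo.pos.ne' hk (by omega) hM hM2 hMo hmc hmk E D hE hD ?_
  rw [← hQ]
  set t : ℕ := s + 2 with ht
  have hY : (((Q ^ E * m : ℕ) : ℝ) + (t:ℕ) * (E * (Q ^ (E - 1) * m) : ℕ) * 2 ^ D
        + 2 ^ D * (Q * k : ℕ) : ℝ) ≤ θ * X := by
    push_cast
    have h1 : (t:ℝ) * (E * ((Q:ℝ) ^ (E - 1) * m)) * 2 ^ D ≤ ε / 8 * ((Q:ℝ) ^ E * m) := by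
      have hQs : (Q:ℝ) ^ E = Q ^ (E - 1) * Q := by
        rw [← pow_succ]; congr 1; omega
      rw [hQs]
      have h2 : (t:ℝ) * E * 2 ^ D ≤ ε / 8 * Q := by
        calc (t:ℝ) * E * 2 ^ D = t * (8 * E * 2 ^ D) / 8 := by ring
          _ ≤ t * (C1 * ε) / 8 := by gcongr
          _ = ε / 8 * (C1 * t) := by ring
          _ ≤ ε / 8 * Q := by gcongr
      calc (t:ℝ) * (E * ((Q:ℝ) ^ (E - 1) * m)) * 2 ^ D
          = (t:ℝ) * E * 2 ^ D * ((Q:ℝ) ^ (E - 1) * m) := by ring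
        _ ≤ ε / 8 * Q * ((Q:ℝ) ^ (E - 1) * m) := by gcongr
        _ = _ := by ring
    have h3 : (2:ℝ) ^ D * (Q * k) ≤ ε / 8 * X := by
      refine le_trans ?_ e3
      calc (2:ℝ) ^ D * (Q * k) ≤ 2 ^ D * ((p ^ 2 * C1 * t) * k) := by gcongr
        _ = _ := by ring
    have h4 : ε / 8 * ((Q:ℝ) ^ E * m) ≤ ε / 8 * X := by
      have : (Q:ℝ) ^ E * m ≤ X := hnup.trans (by nlinarith)
      gcongr
    rw [hθ]
    linarith
  have hkey := num_key s
  rw [← ht, ← hX] at hkey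
  have hs0 : (0:ℝ) < s.factorial := by exact_mod_cast Nat.factorial_pos s
  have e4' : (t:ℝ) ^ 2 * θ ^ s * (4 * k ^ 2 * 2 ^ (2 * D) * Real.exp 1 ^ 2) ≤ 1 := by
    have h := e4.le
    rw [le_div_iff₀ (by positivity), ht, pow_add] at h
    have hθ2 : 0 < θ ^ 2 := by positivity
    rw [← ht] at h
    apply le_of_mul_le_mul_right _ hθ2
    calc _ = (t:ℝ) ^ 2 * (θ ^ s * θ ^ 2) * (4 * k ^ 2 * 2 ^ (2 * D) * Real.exp 1 ^ 2) := by ring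
      _ ≤ θ ^ 2 := h
      _ = 1 * θ ^ 2 := by ring
  calc _ ≤ 2 * (t:ℝ)^2 * (k:ℝ)^2 * ((1/2:ℝ)^(t.choose 2) * (2 ^ (2 * D) *
        ((θ * X) ^ s / s.factorial))) := by gcongr
    _ = 2 * (t:ℝ)^2 * (k:ℝ)^2 * 2 ^ (2 * D) * θ ^ s *
        ((1/2:ℝ)^(t.choose 2) * X ^ s / s.factorial) := by rw [mul_pow]; ring
    _ ≤ 2 * (t:ℝ)^2 * (k:ℝ)^2 * 2 ^ (2 * D) * θ ^ s * (Real.exp 1 ^ 2 / 2) := by gcongr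
    _ = ((t:ℝ) ^ 2 * θ ^ s * (4 * k ^ 2 * 2 ^ (2 * D) * Real.exp 1 ^ 2)) / 4 := by ring
    _ ≤ 1 / 4 := by gcongr
end

section
/- For all positive integers d and k there exists a constant c = c(d,k) such that the following holds: for every simple graph G with maximum degree at most d and every integer s such that every 2-coloring of the edges of the complete graph K_s contains a monochromatic copy of G, every covering [k]-uniform hypergraph on at least c·s vertices, with any 2-edge-coloring of its edges, contains a monochromatic Berge copy of G. In particular, R̂^[k](BG, BG) ≤ c·R(G,G) for all graphs G of maximum degree at most d. -/
open Classical in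
/-- Greedy proper colouring with `d+1` colours. -/
theorem exists_greedy_coloring {n d : ℕ} (G : SimpleGraph (Fin n))
    (hdeg : ∀ v : Fin n, (G.neighborFinset v).card ≤ d) :
    ∃ κ : Fin n → ℕ, (∀ v, κ v < d + 1) ∧ ∀ u v, G.Adj u v → κ u ≠ κ v := by
  have key : ∀ S : Finset (Fin n), ∃ κ : Fin n → ℕ, (∀ v, κ v < d + 1) ∧
      ∀ u ∈ S, ∀ v ∈ S, G.Adj u v → κ u ≠ κ v := by
    intro S
    induction S using Finset.induction_on with
    | empty => exact ⟨fun _ => 0, by simp, by simp⟩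
    | insert a S ha ih =>
      obtain ⟨κ, hκ, hp⟩ := ih
      have : ∃ c ∈ Finset.range (d + 1), c ∉ (G.neighborFinset a).image κ := by
        apply Finset.exists_mem_notMem_of_card_lt_card
        have h1 : ((G.neighborFinset a).image κ).card ≤ (G.neighborFinset a).card :=
          Finset.card_image_le
        have := hdeg a
        simp only [Finset.card_range]
        omega
      obtain ⟨c, hc, hcn⟩ := this
      have hc' : ∀ w, G.Adj a w → κ w ≠ c := by
        intro w hw he
        exact hcn (Finset.mem_image.2 ⟨w, by simpa using hw, he⟩)
      refine ⟨Function.update κ a c, ?_, ?_⟩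
      · intro v
        by_cases h : v = a
        · subst h; simpa using hc
        · simpa [h] using hκ v
      · intro u hu v hv huv
        have hne := huv.ne
        by_cases h : u = a
        · subst h
          have hv' : v ≠ u := hne.symm
          simp only [Function.update_self, Function.update_of_ne hv']
          exact (hc' v huv).symm
        · by_cases h2 : v = a
          · subst h2
            simp only [Function.update_self, Function.update_of_ne h]
            exact hc' u huv.symm
          · simp only [Function.update_of_ne h, Function.update_of_ne h2]
            exact hp u (Finset.mem_of_mem_insert_of_ne hu h) v
              (Finset.mem_of_mem_insert_of_ne hv h2) huv
  obtain ⟨κ, h1, h2⟩ := key Finset.univ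
  exact ⟨κ, h1, fun u v => h2 u (Finset.mem_univ _) v (Finset.mem_univ _)⟩

open Classical in
/-- `r` is bi-dense on `W`. -/
def BiDense {V : Type*} (r : V → V → Prop) (ρ δ : ℝ) (W : Finset V) : Prop :=
  ∀ X ⊆ W, ∀ Y ⊆ W, ρ * W.card ≤ X.card → ρ * W.card ≤ Y.card →
    ∃ x ∈ X, δ * Y.card ≤ ((Y.filter (fun z => r x z)).card : ℝ)

open Classical in
/-- Either a large bi-dense set, or a long chain of sets sparse to each other. -/
theorem biDense_or_chain {V : Type*} (r : V → V → Prop) (ρ δ : ℝ) (h0 : 0 < ρ) (h1 : ρ ≤ 1)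
    (h : ℕ) : ∀ W : Finset V,
    (∃ W' ⊆ W, ρ ^ h * W.card ≤ W'.card ∧ BiDense r ρ δ W') ∨
    ∃ A : ℕ → Finset V, (∀ i < h, ρ ^ h * W.card ≤ (A i).card ∧ A i ⊆ W) ∧
      ∀ i j, i < j → j < h → ∀ y ∈ A i,
        (((A j).filter (fun z => r y z)).card : ℝ) ≤ δ * (A j).card := by
  induction h with
  | zero => intro W; right; exact ⟨fun _ => ∅, by simp, by simp⟩
  | succ h ih =>
    intro W
    have hp : ρ ^ (h + 1) ≤ ρ := by
      have := pow_le_one₀ (n := h) h0.le h1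
      rw [pow_succ]; nlinarith
    have hW : (0 : ℝ) ≤ W.card := by positivity
    by_cases hb : BiDense r ρ δ W
    · left
      exact ⟨W, subset_rfl, by nlinarith, hb⟩
    · unfold BiDense at hb
      push Not at hb
      obtain ⟨X, hX, Y, hY, hXc, hYc, hXY⟩ := hb
      have hpX : ρ ^ (h + 1) * W.card ≤ ρ ^ h * X.card := by
        rw [pow_succ, mul_assoc]
        exact mul_le_mul_of_nonneg_left hXc (by positivity)
      rcases ih X with ⟨W', hW', hc, hd⟩ | ⟨A, hA, hA2⟩
      · left
        exact ⟨W', hW'.trans hX, hpX.trans hc, hd⟩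
      · right
        refine ⟨fun i => if i < h then A i else Y, ?_, ?_⟩
        · intro i hi
          by_cases hih : i < h
          · simp only [hih, if_true]
            exact ⟨hpX.trans (hA i hih).1, (hA i hih).2.trans hX⟩
          · simp only [hih, if_false]
            exact ⟨by nlinarith, hY⟩
        · intro i j hij hj y hy
          have hi : i < h := by omega
          simp only [hi, if_true] at hy
          by_cases hjh : j < h
          · simp only [hjh, if_true]
            exact hA2 i j hij hjh y hy
          · simp only [hjh, if_false]
            exact (hXY y ((hA i hi).2 hy)).le

open Classical in
/-- Greedy embedding into a bi-dense relation. -/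
theorem embed_biDense {n d : ℕ} {V : Type*} (G : SimpleGraph (Fin n))
    (hdeg : ∀ v : Fin n, (G.neighborFinset v).card ≤ d)
    (r : V → V → Prop) (hr : ∀ x y, r x y → r y x) (ρ δ : ℝ) (hδ0 : 0 < δ) (hδ1 : δ ≤ 1)
    (hρ : ρ ≤ δ ^ d) (hρd : d * ρ ≤ δ ^ d / 4)
    (W : Finset V) (hW : BiDense r ρ δ W)
    (Good : Finset (Fin n) → (Fin n → V) → Prop) (L : ℝ)
    (hL : L < δ ^ d * W.card / 4) (y0 : Fin n → V) (hG0 : Good ∅ y0)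
    (hGs : ∀ S y a, a ∉ S → Good S y → ∃ B : Finset V, (B.card : ℝ) ≤ L ∧
      ∀ x, x ∉ B → Good (insert a S) (Function.update y a x)) :
    ∃ y, Good Finset.univ y ∧ ∀ u v, G.Adj u v → r (y u) (y v) := by
  have key : ∀ S : Finset (Fin n), ∃ y, Good S y ∧
      (∀ u ∈ S, ∀ v ∈ S, G.Adj u v → r (y u) (y v)) ∧
      ∀ v ∉ S, δ ^ ((G.neighborFinset v ∩ S).card) * W.card ≤
        ((W.filter (fun x => ∀ u ∈ G.neighborFinset v ∩ S, r (y u) x)).card : ℝ) := by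
    intro S
    induction S using Finset.induction_on with
    | empty => exact ⟨y0, hG0, by simp, by simp⟩
    | insert a S ha ih =>
      obtain ⟨y, hg, he, hc⟩ := ih
      obtain ⟨B, hB, hBg⟩ := hGs S y a ha hg
      set C : Fin n → Finset V :=
        fun v => W.filter (fun x => ∀ u ∈ G.neighborFinset v ∩ S, r (y u) x) with hC
      have hCW : ∀ v, C v ⊆ W := fun v => Finset.filter_subset _ _
      have hCd : ∀ v ∉ S, δ ^ d * W.card ≤ (C v).card := by
        intro v hv
        refine le_trans ?_ (hc v hv)
        refine mul_le_mul_of_nonneg_right ?_ (by positivity)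
        exact pow_le_pow_of_le_one hδ0.le hδ1
          ((Finset.card_le_card Finset.inter_subset_left).trans (hdeg v))
      have hWp : (0 : ℝ) ≤ W.card := by positivity
      have hρW : ∀ v ∉ S, ρ * W.card ≤ (C v).card := fun v hv =>
        le_trans (mul_le_mul_of_nonneg_right hρ hWp) (hCd v hv)
      set D : Fin n → Finset V := fun w => (C a).filter
        (fun x => (((C w).filter (fun z => r x z)).card : ℝ) < δ * (C w).card) with hD
      have hDc : ∀ w ∉ S, ((D w).card : ℝ) ≤ ρ * W.card := by
        intro w hw
        by_contra hcon
        push Not at hcon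
        obtain ⟨x, hx, hx2⟩ := hW (D w) ((Finset.filter_subset _ _).trans (hCW a)) (C w) (hCW w)
          hcon.le (hρW w hw)
        have := (Finset.mem_filter.1 hx).2
        linarith
      set U : Finset V := B ∪ (G.neighborFinset a \ S).biUnion D with hU
      have hUc : (U.card : ℝ) ≤ L + d * (ρ * W.card) := by
        have e1 : (U.card : ℝ) ≤ B.card + ((G.neighborFinset a \ S).biUnion D).card := by
          exact_mod_cast Finset.card_union_le _ _
        have e2 : (((G.neighborFinset a \ S).biUnion D).card : ℝ) ≤
            ∑ w ∈ G.neighborFinset a \ S, ((D w).card : ℝ) := by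
          exact_mod_cast Finset.card_biUnion_le
        have e3 : ∑ w ∈ G.neighborFinset a \ S, ((D w).card : ℝ) ≤
            (G.neighborFinset a \ S).card • (ρ * W.card) := by
          apply Finset.sum_le_card_nsmul
          intro w hw
          exact hDc w (Finset.mem_sdiff.1 hw).2
        rw [nsmul_eq_mul] at e3
        by_cases hemp : (G.neighborFinset a \ S) = ∅
        · have hρ' : 0 ≤ d * (ρ * W.card) := by
            rcases Nat.eq_zero_or_pos d with h | h
            · simp [h]
            · have := hDc a ha
              have h' : (0 : ℝ) ≤ (D a).card := by positivity
              have : 0 ≤ ρ * W.card := h'.trans this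
              positivity
          simp only [hemp, Finset.biUnion_empty, Finset.card_empty, Nat.cast_zero] at e1
          linarith
        · obtain ⟨w, hw⟩ := Finset.nonempty_iff_ne_empty.2 hemp
          have hρ' : 0 ≤ ρ * W.card :=
            le_trans (by positivity) (hDc w (Finset.mem_sdiff.1 hw).2)
          have e4 : ((G.neighborFinset a \ S).card : ℝ) ≤ d := by
            exact_mod_cast (Finset.card_le_card Finset.sdiff_subset).trans (hdeg a)
          have := mul_le_mul_of_nonneg_right e4 hρ'
          linarith
      have hlt : U.card < (C a).card := by
        have h1 := hCd a ha
        have h2 : d * (ρ * W.card) ≤ δ ^ d * W.card / 4 := by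
          have := mul_le_mul_of_nonneg_right hρd hWp
          linarith
        have h3 : 0 ≤ δ ^ d * W.card := by positivity
        have : (U.card : ℝ) < (C a).card := by linarith
        exact_mod_cast this
      obtain ⟨x, hxC, hxU⟩ := Finset.exists_mem_notMem_of_card_lt_card hlt
      have hxB : x ∉ B := fun h => hxU (Finset.mem_union_left _ h)
      have hxD : ∀ w ∉ S, G.Adj a w → δ * (C w).card ≤ (((C w).filter (fun z => r x z)).card : ℝ) := by
        intro w hw haw
        by_contra hcon
        push Not at hcon
        apply hxU
        refine Finset.mem_union_right _ (Finset.mem_biUnion.2 ⟨w, ?_, ?_⟩)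
        · simp [haw, hw]
        · exact Finset.mem_filter.2 ⟨hxC, hcon⟩
      have hxr : ∀ u ∈ S, G.Adj a u → r (y u) x := by
        intro u hu hau
        exact (Finset.mem_filter.1 hxC).2 u (by simp [hu, hau])
      have hup : ∀ u ∈ S, Function.update y a x u = y u := by
        intro u hu
        exact Function.update_of_ne (fun h => ha (by rwa [h] at hu)) _ _
      refine ⟨Function.update y a x, hBg x hxB, ?_, ?_⟩
      · intro u hu v hv huv
        rw [Finset.mem_insert] at hu; rcases hu with rfl | hu
        · rw [Finset.mem_insert] at hv; rcases hv with rfl | hv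
          · exact absurd huv (G.loopless.irrefl _)
          · rw [hup v hv, Function.update_self]
            exact hr _ _ (hxr v hv huv)
        · rw [Finset.mem_insert] at hv; rcases hv with rfl | hv
          · rw [hup u hu, Function.update_self]
            exact hxr u hu huv.symm
          · rw [hup u hu, hup v hv]
            exact he u hu v hv huv
      · intro v hv
        have hva : v ≠ a := fun h => hv (h ▸ Finset.mem_insert_self _ _)
        have hvS : v ∉ S := fun h => hv (Finset.mem_insert_of_mem h)
        by_cases hav : G.Adj a v
        · have hi : G.neighborFinset v ∩ insert a S = insert a (G.neighborFinset v ∩ S) := by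
            rw [Finset.inter_insert_of_mem]
            simpa using hav.symm
          rw [hi, Finset.card_insert_of_notMem (by simp [ha])]
          have h1 := hxD v hvS hav
          have h2 := hc v hvS
          have h3 : (C v).filter (fun z => r x z) ⊆ W.filter (fun z =>
              ∀ u ∈ insert a (G.neighborFinset v ∩ S), r (Function.update y a x u) z) := by
            intro z hz
            obtain ⟨hz1, hz2⟩ := Finset.mem_filter.1 hz
            obtain ⟨hz3, hz4⟩ := Finset.mem_filter.1 hz1
            refine Finset.mem_filter.2 ⟨hz3, ?_⟩
            intro u hu
            rw [Finset.mem_insert] at hu; rcases hu with rfl | hu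
            · rwa [Function.update_self]
            · rw [hup u (Finset.mem_inter.1 hu).2]
              exact hz4 u hu
          have h4 : (((C v).filter (fun z => r x z)).card : ℝ) ≤ _ :=
            Nat.cast_le.2 (Finset.card_le_card h3)
          refine le_trans ?_ (h1.trans h4)
          rw [pow_succ, mul_comm _ δ, mul_assoc]
          exact mul_le_mul_of_nonneg_left h2 hδ0.le
        · have hi : G.neighborFinset v ∩ insert a S = G.neighborFinset v ∩ S := by
            rw [Finset.inter_insert_of_notMem]
            simpa using fun h => hav (G.adj_symm h)
          rw [hi]
          refine (hc v hvS).trans (Nat.cast_le.2 (Finset.card_le_card ?_))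
          intro z hz
          obtain ⟨hz3, hz4⟩ := Finset.mem_filter.1 hz
          refine Finset.mem_filter.2 ⟨hz3, ?_⟩
          intro u hu
          rw [hup u (Finset.mem_inter.1 hu).2]
          exact hz4 u hu
  obtain ⟨y, h1, h2, -⟩ := key Finset.univ
  exact ⟨y, h1, fun u v => h2 u (Finset.mem_univ _) v (Finset.mem_univ _)⟩

open Classical in
/-- Greedy embedding into the complement of `r` along a sparse chain. -/
theorem embed_chain {n d : ℕ} {V : Type*} (G : SimpleGraph (Fin n))
    (hdeg : ∀ v : Fin n, (G.neighborFinset v).card ≤ d)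
    (r : V → V → Prop) (hr : ∀ x y, r x y → r y x) (δ : ℝ) (hδ0 : 0 < δ) (hδd : d * δ ≤ 1 / 2)
    (A : ℕ → Finset V)
    (hA : ∀ i j, i < j → j < d + 1 → ∀ y ∈ A i,
        (((A j).filter (fun z => r y z)).card : ℝ) ≤ δ * (A j).card)
    (Good : Finset (Fin n) → (Fin n → V) → Prop) (L : ℝ)
    (hL : ∀ i < d + 1, L < (A i).card / 2) (y0 : Fin n → V) (hG0 : Good ∅ y0)
    (hGs : ∀ S y a, a ∉ S → Good S y → ∃ B : Finset V, (B.card : ℝ) ≤ L ∧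
      ∀ x, x ∉ B → Good (insert a S) (Function.update y a x)) :
    ∃ y, Good Finset.univ y ∧ ∀ u v, G.Adj u v → ¬ r (y u) (y v) := by
  obtain ⟨κ, hκ, hκp⟩ := exists_greedy_coloring G hdeg
  have key : ∀ S : Finset (Fin n), ∃ y, Good S y ∧
      (∀ u ∈ S, ∀ v ∈ S, G.Adj u v → ¬ r (y u) (y v)) ∧ ∀ v ∈ S, y v ∈ A (κ v) := by
    intro S
    induction S using Finset.induction_on_max_value κ with
    | empty => exact ⟨y0, hG0, by simp, by simp⟩
    | insert a S ha hmax ih =>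
      obtain ⟨y, hg, he, hc⟩ := ih
      obtain ⟨B, hB, hBg⟩ := hGs S y a ha hg
      set D : Fin n → Finset V := fun u => (A (κ a)).filter (fun z => r (y u) z) with hD
      have hDc : ∀ u ∈ G.neighborFinset a ∩ S, ((D u).card : ℝ) ≤ δ * (A (κ a)).card := by
        intro u hu
        obtain ⟨hu1, hu2⟩ := Finset.mem_inter.1 hu
        have hau : G.Adj a u := by simpa using hu1
        exact hA (κ u) (κ a) (lt_of_le_of_ne (hmax u hu2) (hκp a u hau).symm) (hκ a) _ (hc u hu2)
      set U : Finset V := B ∪ (G.neighborFinset a ∩ S).biUnion D with hU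
      have hUc : (U.card : ℝ) ≤ L + d * (δ * (A (κ a)).card) := by
        have e1 : (U.card : ℝ) ≤ B.card + ((G.neighborFinset a ∩ S).biUnion D).card := by
          exact_mod_cast Finset.card_union_le _ _
        have e2 : (((G.neighborFinset a ∩ S).biUnion D).card : ℝ) ≤
            ∑ w ∈ G.neighborFinset a ∩ S, ((D w).card : ℝ) := by
          exact_mod_cast Finset.card_biUnion_le
        have e3 : ∑ w ∈ G.neighborFinset a ∩ S, ((D w).card : ℝ) ≤
            (G.neighborFinset a ∩ S).card • (δ * (A (κ a)).card) :=
          Finset.sum_le_card_nsmul _ _ _ hDc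
        rw [nsmul_eq_mul] at e3
        have e4 : ((G.neighborFinset a ∩ S).card : ℝ) ≤ d := by
          exact_mod_cast (Finset.card_le_card Finset.inter_subset_left).trans (hdeg a)
        have hp : 0 ≤ δ * (A (κ a)).card := by positivity
        have := mul_le_mul_of_nonneg_right e4 hp
        linarith
      have hlt : U.card < (A (κ a)).card := by
        have h1 := hL (κ a) (hκ a)
        have hp : (0 : ℝ) ≤ (A (κ a)).card := by positivity
        have h2 := mul_le_mul_of_nonneg_right hδd hp
        have : (U.card : ℝ) < (A (κ a)).card := by linarith
        exact_mod_cast this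
      obtain ⟨x, hxC, hxU⟩ := Finset.exists_mem_notMem_of_card_lt_card hlt
      have hxB : x ∉ B := fun h => hxU (Finset.mem_union_left _ h)
      have hxr : ∀ u ∈ S, G.Adj a u → ¬ r (y u) x := by
        intro u hu hau hru
        apply hxU
        refine Finset.mem_union_right _ (Finset.mem_biUnion.2 ⟨u, by simp [hu, hau], ?_⟩)
        exact Finset.mem_filter.2 ⟨hxC, hru⟩
      have hup : ∀ u ∈ S, Function.update y a x u = y u := by
        intro u hu
        exact Function.update_of_ne (fun h => ha (by rwa [h] at hu)) _ _
      refine ⟨Function.update y a x, hBg x hxB, ?_, ?_⟩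
      · intro u hu v hv huv
        rw [Finset.mem_insert] at hu; rcases hu with rfl | hu
        · rw [Finset.mem_insert] at hv; rcases hv with rfl | hv
          · exact absurd huv (G.loopless.irrefl _)
          · rw [hup v hv, Function.update_self]
            exact fun h => hxr v hv huv (hr _ _ h)
        · rw [Finset.mem_insert] at hv; rcases hv with rfl | hv
          · rw [hup u hu, Function.update_self]
            exact hxr u hu huv.symm
          · rw [hup u hu, hup v hv]
            exact he u hu v hv huv
      · intro v hv
        rw [Finset.mem_insert] at hv; rcases hv with rfl | hv
        · rwa [Function.update_self]
        · rw [hup v hv]; exact hc v hv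
  obtain ⟨y, h1, h2, -⟩ := key Finset.univ
  exact ⟨y, h1, fun u v => h2 u (Finset.mem_univ _) v (Finset.mem_univ _)⟩

open Classical in
/-- Two vertices are in conflict if many third vertices see them through a common hyperedge. -/
def ConflictPair {N : ℕ} (g : Sym2 (Fin N) → Finset (Fin N)) (q : ℕ) (u v : Fin N) : Prop :=
  u ≠ v ∧ N < q * (Finset.univ.filter (fun x => x ≠ u ∧ x ≠ v ∧ g s(x, u) = g s(x, v))).card

open Classical in
theorem conflict_card {N k q : ℕ} (g : Sym2 (Fin N) → Finset (Fin N))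
    (hgk : ∀ u v, u ≠ v → (g s(u, v)).card ≤ k)
    (hgm : ∀ u v, u ≠ v → u ∈ g s(u, v) ∧ v ∈ g s(u, v)) (u : Fin N) :
    (Finset.univ.filter (fun v => ConflictPair g q u v)).card ≤ q * k := by
  have hN : 0 < N := u.pos
  set T := Finset.univ.filter (fun v => ConflictPair g q u v) with hT
  set F : Fin N → Finset (Fin N) := fun v =>
    Finset.univ.filter (fun x => x ≠ u ∧ x ≠ v ∧ g s(x, u) = g s(x, v)) with hF
  have h1 : T.card * N ≤ ∑ v ∈ T, q * (F v).card := by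
    rw [← smul_eq_mul]
    apply Finset.card_nsmul_le_sum
    intro v hv
    exact (Finset.mem_filter.1 hv).2.2.le
  have h2 : ∑ v ∈ T, (F v).card ≤ N * k := by
    have e1 : ∑ v ∈ T, (F v).card = ∑ v ∈ T, (Finset.univ.bipartiteBelow
        (fun x v => x ≠ u ∧ x ≠ v ∧ g s(x, u) = g s(x, v)) v).card := rfl
    rw [e1, ← Finset.sum_card_bipartiteAbove_eq_sum_card_bipartiteBelow]
    have : ∀ x ∈ (Finset.univ : Finset (Fin N)), (T.bipartiteAbove
        (fun x v => x ≠ u ∧ x ≠ v ∧ g s(x, u) = g s(x, v)) x).card ≤ k := by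
      intro x _
      by_cases hx : x = u
      · have : T.bipartiteAbove
            (fun x v => x ≠ u ∧ x ≠ v ∧ g s(x, u) = g s(x, v)) x = ∅ := by
          simp [Finset.bipartiteAbove, hx]
        simp [this]
      · refine le_trans (Finset.card_le_card ?_) (hgk x u hx)
        intro v hv
        obtain ⟨-, -, h2, h3⟩ := Finset.mem_filter.1 hv
        rw [h3]
        exact (hgm x v h2).2
    simpa using Finset.sum_le_card_nsmul _ _ _ this
  rw [← Finset.mul_sum] at h1
  have h3 : T.card * N ≤ (q * k) * N := by nlinarith
  exact Nat.le_of_mul_le_mul_right h3 hN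

/-- Invariant of the greedy embedding: injective, no conflicts, distinct hyperedges. -/
def GoodState {n N : ℕ} (G : SimpleGraph (Fin n)) (g : Sym2 (Fin N) → Finset (Fin N)) (q : ℕ)
    (S : Finset (Fin n)) (y : Fin n → Fin N) : Prop :=
  (∀ u ∈ S, ∀ v ∈ S, y u = y v → u = v) ∧
  (∀ u ∈ S, ∀ v ∈ S, ¬ ConflictPair g q (y u) (y v)) ∧
  (∀ u ∈ S, ∀ v ∈ S, ∀ u' ∈ S, ∀ v' ∈ S, G.Adj u v → G.Adj u' v' →
    g s(y u, y v) = g s(y u', y v') → s(u, v) = s(u', v'))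

theorem conflictPair_symm {N : ℕ} (g : Sym2 (Fin N) → Finset (Fin N)) (q : ℕ) (u v : Fin N)
    (h : ConflictPair g q u v) : ConflictPair g q v u := by
  classical
  refine ⟨h.1.symm, lt_of_lt_of_le h.2 (Nat.mul_le_mul_left _ (Finset.card_le_card ?_))⟩
  intro x hx
  simp only [Finset.mem_filter, Finset.mem_univ, true_and] at hx ⊢
  exact ⟨hx.2.1, hx.1, hx.2.2.symm⟩

open Classical in
theorem goodState_extend {n N d k q : ℕ} (G : SimpleGraph (Fin n))
    (hdeg : ∀ v : Fin n, (G.neighborFinset v).card ≤ d)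
    (g : Sym2 (Fin N) → Finset (Fin N))
    (hgk : ∀ u v, u ≠ v → (g s(u, v)).card ≤ k)
    (hgm : ∀ u v, u ≠ v → u ∈ g s(u, v) ∧ v ∈ g s(u, v))
    (S : Finset (Fin n)) (y : Fin n → Fin N) (a : Fin n) (ha : a ∉ S)
    (hg : GoodState G g q S y) :
    ∃ B : Finset (Fin N), q * B.card ≤ d * d * N + q * (n * (1 + d * k + q * k)) ∧
      ∀ x, x ∉ B → GoodState G g q (insert a S) (Function.update y a x) := by
  obtain ⟨hinj, hcf, hdist⟩ := hg
  set B1 : Finset (Fin N) := S.image y with hB1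
  set B2 : Finset (Fin N) := S.biUnion (fun u => (G.neighborFinset u ∩ S).biUnion
    (fun v => g s(y u, y v))) with hB2
  set B3 : Finset (Fin N) := S.biUnion (fun u => Finset.univ.filter
    (fun v => ConflictPair g q (y u) v)) with hB3
  set P : Finset (Fin n × Fin n) :=
    ((G.neighborFinset a ∩ S) ×ˢ (G.neighborFinset a ∩ S)).filter (fun p => p.1 ≠ p.2) with hP
  set B4 : Finset (Fin N) := P.biUnion (fun p => Finset.univ.filter
    (fun x => x ≠ y p.1 ∧ x ≠ y p.2 ∧ g s(x, y p.1) = g s(x, y p.2))) with hB4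
  have hSn : S.card ≤ n := by simpa using Finset.card_le_univ S
  have hNS : ∀ u, (G.neighborFinset u ∩ S).card ≤ d := fun u =>
    (Finset.card_le_card Finset.inter_subset_left).trans (hdeg u)
  have c1 : B1.card ≤ n := Finset.card_image_le.trans hSn
  have c2 : B2.card ≤ n * (d * k) := by
    refine (Finset.card_biUnion_le_card_mul _ _ (d * k) ?_).trans (Nat.mul_le_mul_right _ hSn)
    intro u hu
    refine (Finset.card_biUnion_le_card_mul _ _ k ?_).trans (Nat.mul_le_mul_right _ (hNS u))
    intro v hv
    obtain ⟨hv1, hv2⟩ := Finset.mem_inter.1 hv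
    apply hgk
    intro h
    have := hinj u hu v hv2 h
    subst this
    simp at hv1
  have c3 : B3.card ≤ n * (q * k) := by
    refine (Finset.card_biUnion_le_card_mul _ _ (q * k) ?_).trans (Nat.mul_le_mul_right _ hSn)
    intro u hu
    exact conflict_card g hgk hgm (y u)
  have c4 : q * B4.card ≤ d * d * N := by
    have e1 : B4.card ≤ ∑ p ∈ P, (Finset.univ.filter
      (fun x => x ≠ y p.1 ∧ x ≠ y p.2 ∧ g s(x, y p.1) = g s(x, y p.2))).card :=
      Finset.card_biUnion_le
    have e2 : ∑ p ∈ P, q * (Finset.univ.filter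
      (fun x => x ≠ y p.1 ∧ x ≠ y p.2 ∧ g s(x, y p.1) = g s(x, y p.2))).card ≤ P.card • N := by
      apply Finset.sum_le_card_nsmul
      intro p hp
      obtain ⟨hp1, hp2⟩ := Finset.mem_filter.1 hp
      obtain ⟨hp3, hp4⟩ := Finset.mem_product.1 hp1
      have m1 := (Finset.mem_inter.1 hp3).2
      have m2 := (Finset.mem_inter.1 hp4).2
      by_contra hcon
      push Not at hcon
      exact hcf p.1 m1 p.2 m2 ⟨fun h => hp2 (hinj _ m1 _ m2 h), hcon⟩
    have e3 : P.card ≤ d * d := by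
      refine (Finset.card_filter_le _ _).trans ?_
      rw [Finset.card_product]
      exact Nat.mul_le_mul (hNS a) (hNS a)
    rw [← Finset.mul_sum, smul_eq_mul] at e2
    exact (Nat.mul_le_mul_left q e1).trans (e2.trans (Nat.mul_le_mul_right _ e3))
  refine ⟨(B1 ∪ B2 ∪ B3) ∪ B4, ?_, ?_⟩
  · have t1 := Finset.card_union_le (B1 ∪ B2 ∪ B3) B4
    have t2 := Finset.card_union_le (B1 ∪ B2) B3
    have t3 := Finset.card_union_le B1 B2
    have t4 : (B1 ∪ B2 ∪ B3).card ≤ n * (1 + d * k + q * k) := by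
      have : n * (1 + d * k + q * k) = n + n * (d * k) + n * (q * k) := by ring
      omega
    have t5 := Nat.mul_le_mul_left q t1
    have t6 := Nat.mul_le_mul_left q t4
    rw [mul_add] at t5
    omega
  · intro x hx
    simp only [Finset.mem_union, not_or] at hx
    obtain ⟨⟨⟨x1, x2⟩, x3⟩, x4⟩ := hx
    have hup : ∀ u ∈ S, Function.update y a x u = y u := by
      intro u hu
      exact Function.update_of_ne (fun h => ha (by rwa [h] at hu)) _ _
    have hx1 : ∀ u ∈ S, y u ≠ x := fun u hu h => x1 (Finset.mem_image.2 ⟨u, hu, h⟩)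
    have hx2 : ∀ u ∈ S, ∀ v ∈ S, G.Adj u v → x ∉ g s(y u, y v) := by
      intro u hu v hv huv h
      exact x2 (Finset.mem_biUnion.2 ⟨u, hu, Finset.mem_biUnion.2 ⟨v, by simp [hv, huv], h⟩⟩)
    have hx3 : ∀ u ∈ S, ¬ ConflictPair g q (y u) x := by
      intro u hu h
      exact x3 (Finset.mem_biUnion.2 ⟨u, hu, by simpa using h⟩)
    have hx4 : ∀ u ∈ S, ∀ v ∈ S, G.Adj a u → G.Adj a v → g s(x, y u) = g s(x, y v) → u = v := by
      intro u hu v hv hau hav h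
      by_contra hne
      apply x4
      refine Finset.mem_biUnion.2 ⟨(u, v), ?_, ?_⟩
      · simp [hP, hu, hv, hau, hav, hne]
      · simp only [Finset.mem_filter, Finset.mem_univ, true_and]
        exact ⟨(hx1 u hu).symm, (hx1 v hv).symm, h⟩
    -- description of edges inside `insert a S`
    have hedge : ∀ u ∈ insert a S, ∀ v ∈ insert a S, G.Adj u v →
        (u ∈ S ∧ v ∈ S ∧ s(Function.update y a x u, Function.update y a x v) = s(y u, y v)) ∨
        ∃ w ∈ S, G.Adj a w ∧ s(u, v) = s(a, w) ∧
          s(Function.update y a x u, Function.update y a x v) = s(x, y w) := by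
      intro u hu v hv huv
      rw [Finset.mem_insert] at hu; rcases hu with rfl | hu
      · rw [Finset.mem_insert] at hv; rcases hv with rfl | hv
        · exact absurd huv (G.loopless.irrefl _)
        · right
          exact ⟨v, hv, huv, rfl, by rw [hup v hv, Function.update_self]⟩
      · rw [Finset.mem_insert] at hv; rcases hv with rfl | hv
        · right
          exact ⟨u, hu, huv.symm, Sym2.eq_swap, by
            rw [hup u hu, Function.update_self, Sym2.eq_swap]⟩
        · left
          exact ⟨hu, hv, by rw [hup u hu, hup v hv]⟩
    refine ⟨?_, ?_, ?_⟩
    · intro u hu v hv h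
      rw [Finset.mem_insert] at hu; rcases hu with rfl | hu
      · rw [Finset.mem_insert] at hv; rcases hv with rfl | hv
        · rfl
        · rw [hup v hv, Function.update_self] at h
          exact absurd h.symm (hx1 v hv)
      · rw [Finset.mem_insert] at hv; rcases hv with rfl | hv
        · rw [hup u hu, Function.update_self] at h
          exact absurd h (hx1 u hu)
        · rw [hup u hu, hup v hv] at h
          exact hinj u hu v hv h
    · intro u hu v hv h
      rw [Finset.mem_insert] at hu; rcases hu with rfl | hu
      · rw [Finset.mem_insert] at hv; rcases hv with rfl | hv
        · exact h.1 rfl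
        · rw [hup v hv, Function.update_self] at h
          exact hx3 v hv (conflictPair_symm _ _ _ _ h)
      · rw [Finset.mem_insert] at hv; rcases hv with rfl | hv
        · rw [hup u hu, Function.update_self] at h
          exact hx3 u hu h
        · rw [hup u hu, hup v hv] at h
          exact hcf u hu v hv h
    · intro u hu v hv u' hu' v' hv' huv huv' h
      rcases hedge u hu v hv huv with ⟨m1, m2, e⟩ | ⟨w, hw, haw, e1, e⟩
      · rcases hedge u' hu' v' hv' huv' with ⟨m1', m2', e'⟩ | ⟨w', hw', haw', e1', e'⟩
        · rw [e, e'] at h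
          exact hdist u m1 v m2 u' m1' v' m2' huv huv' h
        · rw [e, e'] at h
          exact absurd (h ▸ (hgm x (y w') (hx1 w' hw').symm).1) (hx2 u m1 v m2 huv)
      · rcases hedge u' hu' v' hv' huv' with ⟨m1', m2', e'⟩ | ⟨w', hw', haw', e1', e'⟩
        · rw [e, e'] at h
          exact absurd (h ▸ (hgm x (y w) (hx1 w hw).symm).1) (hx2 u' m1' v' m2' huv')
        · rw [e, e'] at h
          rw [e1, e1', hx4 w hw w' hw' haw haw' h]

/-- For all positive `d, k` there is a constant `c` such that for every graph `G` of
maximum degree at most `d` and every `s` with the Ramsey property for `(G, G)`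
(every 2-coloring of `K_s` has a monochromatic copy of `G`), every 2-colored
covering `[k]`-uniform hypergraph on at least `c·s` vertices contains a
monochromatic Berge copy of `G`; i.e. `R̂^[k](BG, BG) ≤ c·R(G,G)`. -/
theorem cover_ramsey_le_const_mul_ramsey (d k : ℕ) (hd : 0 < d) (hk : 0 < k) :
    ∃ c : ℕ, ∀ (n : ℕ) (G : SimpleGraph (Fin n)),
      (∀ v : Fin n, (G.neighborSet v).ncard ≤ d) →
      ∀ s : ℕ,
      (∀ χ : Sym2 (Fin s) → Bool,
        ∃ (b : Bool) (φ : Fin n → Fin s), Function.Injective φ ∧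
          ∀ u v, G.Adj u v → χ s(φ u, φ v) = b) →
      ∀ N : ℕ, c * s ≤ N →
      ∀ H : Finset (Finset (Fin N)),
        (∀ h ∈ H, 1 ≤ h.card ∧ h.card ≤ k) →
        (∀ u v : Fin N, u ≠ v → ∃ h ∈ H, u ∈ h ∧ v ∈ h) →
        ∀ col : Finset (Fin N) → Bool,
          ∃ b : Bool, HasBergeCopy G H (fun h => col h = b) := by
  classical
  set δ : ℝ := 1 / (2 * d) with hδ
  have hd' : (1 : ℝ) ≤ d := by exact_mod_cast hd
  have hδ0 : 0 < δ := by positivity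
  have hδd : d * δ ≤ 1 / 2 := by rw [hδ]; field_simp; exact le_rfl
  have hδ1 : δ ≤ 1 := by nlinarith
  set ρ : ℝ := δ ^ d / (4 * d) with hρ
  have hδp : 0 < δ ^ d := by positivity
  have hδp1 : δ ^ d ≤ 1 := pow_le_one₀ hδ0.le hδ1
  have hρ0 : 0 < ρ := by positivity
  have hρd : d * ρ ≤ δ ^ d / 4 := by rw [hρ]; field_simp; exact le_rfl
  have hρδ : ρ ≤ δ ^ d := by nlinarith
  have hρ1 : ρ ≤ 1 := hρδ.trans hδp1
  set τ : ℝ := δ ^ d * ρ ^ (d + 1) / 4 with hτ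
  have hτ0 : 0 < τ := by positivity
  obtain ⟨Q, hQ⟩ := exists_nat_gt (1 / τ)
  have hQ0 : (0 : ℝ) < Q := lt_trans (by positivity) hQ
  have hQ1 : (1 : ℝ) / Q < τ := by
    rw [div_lt_iff₀ hQ0]
    rw [div_lt_iff₀ hτ0] at hQ
    linarith
  have hQn : 0 < Q := by exact_mod_cast hQ0
  set q : ℕ := Q * (d * d + 1) with hq
  have hq0 : 0 < q := by positivity
  refine ⟨q * (1 + d * k + q * k), ?_⟩
  intro n G hdeg0 s hs N hN H hH hcov col
  have hdeg : ∀ v : Fin n, (G.neighborFinset v).card ≤ d := by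
    intro v
    have := hdeg0 v
    rwa [Set.ncard_eq_toFinset_card'] at this
  rcases Nat.eq_zero_or_pos n with hn | hn
  · subst hn
    refine ⟨true, fun v => v.elim0, fun _ => ∅, fun v => v.elim0, ?_, ?_⟩
    · intro e
      induction e with | _ u v => exact u.elim0
    · intro e
      induction e with | _ u v => exact u.elim0
  have hns : n ≤ s := by
    obtain ⟨_, φ, hφ, -⟩ := hs (fun _ => true)
    simpa using Fintype.card_le_of_injective φ hφ
  have hNn : q * (n * (1 + d * k + q * k)) ≤ N := by
    refine le_trans ?_ hN
    calc q * (n * (1 + d * k + q * k)) = q * (1 + d * k + q * k) * n := by ring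
      _ ≤ _ := Nat.mul_le_mul_left _ hns
  have hN0 : 0 < N := lt_of_lt_of_le (by positivity) hNn
  have hgex : ∀ e : Sym2 (Fin N), ∃ h : Finset (Fin N), ¬ e.IsDiag → h ∈ H ∧ ∀ v ∈ e, v ∈ h := by
    intro e
    induction e with
    | _ u v =>
      by_cases huv : u = v
      · exact ⟨∅, fun h => absurd (by simpa using huv) h⟩
      · obtain ⟨h, h1, h2, h3⟩ := hcov u v huv
        refine ⟨h, fun _ => ⟨h1, ?_⟩⟩
        intro w hw
        rcases Sym2.mem_iff.1 hw with rfl | rfl <;> assumption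
  choose g hgp using hgex
  have hg : ∀ u v, u ≠ v → g s(u, v) ∈ H ∧ u ∈ g s(u, v) ∧ v ∈ g s(u, v) := by
    intro u v huv
    obtain ⟨h1, h2⟩ := hgp s(u, v) (by simpa using huv)
    exact ⟨h1, h2 u (by simp), h2 v (by simp)⟩
  have hgk : ∀ u v, u ≠ v → (g s(u, v)).card ≤ k := fun u v h => (hH _ (hg u v h).1).2
  have hgm : ∀ u v, u ≠ v → u ∈ g s(u, v) ∧ v ∈ g s(u, v) := fun u v h => (hg u v h).2
  set L : ℝ := N / Q with hL
  have hLτ : L < τ * N := by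
    have : (0 : ℝ) < N := by exact_mod_cast hN0
    have := mul_lt_mul_of_pos_right hQ1 this
    rw [hL]
    calc (N : ℝ) / Q = 1 / Q * N := by ring
      _ < _ := this
  have hGs : ∀ S y a, a ∉ S → GoodState G g q S y → ∃ B : Finset (Fin N), (B.card : ℝ) ≤ L ∧
      ∀ x, x ∉ B → GoodState G g q (insert a S) (Function.update y a x) := by
    intro S y a ha hgs
    obtain ⟨B, hB, hB2⟩ := goodState_extend G hdeg g hgk hgm S y a ha hgs
    refine ⟨B, ?_, hB2⟩
    have h1 : (d * d + 1) * (Q * B.card) ≤ (d * d + 1) * N := by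
      calc (d * d + 1) * (Q * B.card) = q * B.card := by rw [hq]; ring
        _ ≤ d * d * N + q * (n * (1 + d * k + q * k)) := hB
        _ ≤ d * d * N + N := by omega
        _ = _ := by ring
    have h2 : Q * B.card ≤ N := Nat.le_of_mul_le_mul_left h1 (by positivity)
    rw [hL, le_div_iff₀ hQ0]
    have : ((Q * B.card : ℕ) : ℝ) ≤ N := by exact_mod_cast h2
    push_cast at this
    linarith
  let y0 : Fin n → Fin N := fun _ => ⟨0, hN0⟩
  have hG0 : GoodState G g q ∅ y0 := ⟨by simp, by simp, by simp⟩
  have finish : ∀ b y, GoodState G g q Finset.univ y →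
      (∀ u v, G.Adj u v → col (g s(y u, y v)) = b) →
      HasBergeCopy G H (fun h => col h = b) := by
    intro b y hgs hcol
    have hyi : Function.Injective y := fun u v h =>
      hgs.1 u (Finset.mem_univ _) v (Finset.mem_univ _) h
    refine ⟨y, fun e => g (e.map y), hyi, ?_, ?_⟩
    · intro e he e' he' h
      induction e with
      | _ u v =>
        induction e' with
        | _ u' v' =>
          exact hgs.2.2 u (Finset.mem_univ _) v (Finset.mem_univ _) u' (Finset.mem_univ _) v'
            (Finset.mem_univ _) he he' h
    · intro e he
      induction e with
      | _ u v =>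
        have hne : y u ≠ y v := fun h => G.ne_of_adj he (hyi h)
        obtain ⟨h1, h2, h3⟩ := hg _ _ hne
        refine ⟨h1, hcol u v he, ?_⟩
        intro w hw
        rcases Sym2.mem_iff.1 hw with rfl | rfl <;> assumption
  set r : Fin N → Fin N → Prop := fun u v => col (g s(u, v)) = true with hr
  have hrs : ∀ x y, r x y → r y x := by
    intro x y h
    simp only [hr] at h ⊢
    rwa [Sym2.eq_swap]
  have hτL : ∀ M : ℝ, ρ ^ (d + 1) * N ≤ M → L < δ ^ d * M / 4 := by
    intro M hM
    have := mul_le_mul_of_nonneg_left hM hδp.le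
    have e : τ * N = δ ^ d * (ρ ^ (d + 1) * N) / 4 := by rw [hτ]; ring
    linarith
  rcases biDense_or_chain r ρ δ hρ0 hρ1 (d + 1) (Finset.univ : Finset (Fin N)) with
    ⟨W, -, hW, hWd⟩ | ⟨A, hA, hA2⟩
  · rw [Finset.card_univ, Fintype.card_fin] at hW
    obtain ⟨y, h1, h2⟩ := embed_biDense G hdeg r hrs ρ δ hδ0 hδ1 hρδ hρd W hWd
      (GoodState G g q) L (hτL _ hW) y0 hG0 hGs
    exact ⟨true, finish true y h1 h2⟩
  · rw [Finset.card_univ, Fintype.card_fin] at hA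
    obtain ⟨y, h1, h2⟩ := embed_chain G hdeg r hrs δ hδ0 hδd A hA2
      (GoodState G g q) L (fun i hi => by
        have := hτL _ (hA i hi).1
        have h0 : (0 : ℝ) ≤ (A i).card := by positivity
        nlinarith) y0 hG0 hGs
    refine ⟨false, finish false y h1 ?_⟩
    intro u v huv
    have := h2 u v huv
    simpa [hr] using this
end

section
/- (Multicolor Szemerédi regularity lemma) For every real ε > 0 and all positive integers c and m, there exist M and N₀ such that the following holds: if the edges of a simple graph G on n ≥ N₀ vertices are colored with c colors, then there exists a partition of V(G) into disjoint sets A₁, A₂, …, A_k with m ≤ k ≤ M and ||A_i| − |A_j|| ≤ 1 for all i, j, such that all but at most ε·k² of the pairs (A_i, A_j) with i < j are ε-regular simultaneously in every color; here a pair (A_i, A_j) is ε-regular in color s if for all X ⊆ A_i and Y ⊆ A_j with |X| ≥ ε|A_i| and |Y| ≥ ε|A_j| one has |d_s(X, Y) − d_s(A_i, A_j)| < ε, where d_s(X, Y) is the number of edges of color s with one endpoint in X and one in Y, divided by |X|·|Y|. -/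
/-- The edge density `d_s(X, Y)` in color `s`: the number of edges of `G` of color
`s` (under the edge-coloring `χ`) with one endpoint in `X` and the other in `Y`,
divided by `|X|·|Y|`.  (For disjoint `X` and `Y`, each such edge corresponds to
exactly one ordered pair in `X × Y`.) -/
noncomputable def colorDensity {n c : ℕ} (G : SimpleGraph (Fin n))
    (χ : Sym2 (Fin n) → Fin c) (s : Fin c) (X Y : Finset (Fin n)) : ℝ :=
  (({p : Fin n × Fin n | p.1 ∈ X ∧ p.2 ∈ Y ∧ G.Adj p.1 p.2 ∧ χ s(p.1, p.2) = s}.ncard : ℝ)) /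
    ((X.card : ℝ) * (Y.card : ℝ))

/-- The pair `(A, B)` is `ε`-regular simultaneously in every color: for each color
`s` and all `X ⊆ A`, `Y ⊆ B` with `|X| ≥ ε|A|`, `|Y| ≥ ε|B|`, the density
`d_s(X, Y)` differs from `d_s(A, B)` by less than `ε`. -/
def IsMulticolorRegularPair {n c : ℕ} (G : SimpleGraph (Fin n))
    (χ : Sym2 (Fin n) → Fin c) (ε : ℝ) (A B : Finset (Fin n)) : Prop :=
  ∀ s : Fin c, ∀ X ⊆ A, ∀ Y ⊆ B,
    ε * (A.card : ℝ) ≤ (X.card : ℝ) → ε * (B.card : ℝ) ≤ (Y.card : ℝ) →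
      |colorDensity G χ s X Y - colorDensity G χ s A B| < ε

open Finset Fintype SzemerediRegularity Finpartition in
/-- Splitting two parts `U, V` into chunks essentially does not decrease the mean square density of
an arbitrary graph `H`. -/
theorem mcr_chunk_aux {α : Type*} [Fintype α] [DecidableEq α]
    (H : SimpleGraph α) [DecidableRel H.Adj] {U V : Finset α}
    (A : Finpartition U) (B : Finpartition V) (d q : ℕ) (hd : 0 < d) (hq : 0 < q)
    (hA : ∀ s ∈ A.parts, s.card = d ∨ s.card = d + 1)
    (hB : ∀ s ∈ B.parts, s.card = d ∨ s.card = d + 1)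
    (hAq : A.parts.card = q) (hBq : B.parts.card = q) :
    ((d : ℝ) / (d + 1)) ^ 4 * (H.edgeDensity U V : ℝ) ^ 2 ≤
      (∑ ab ∈ A.parts ×ˢ B.parts, (H.edgeDensity ab.1 ab.2 : ℝ) ^ 2) / ((q : ℝ) ^ 2) := by
  have hq' : (0 : ℝ) < q := by exact_mod_cast hq
  have hd' : (0 : ℝ) < d := by exact_mod_cast hd
  set S : ℝ := ∑ ab ∈ A.parts ×ˢ B.parts, (H.edgeDensity ab.1 ab.2 : ℝ) with hS
  have hcardU : (q : ℝ) * d ≤ U.card := by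
    rw [← A.sum_card_parts, ← hAq]
    exact_mod_cast Finset.card_nsmul_le_sum A.parts (fun s => s.card) d
      (fun x hx => by rcases hA x hx with h | h <;> omega)
  have hcardV : (q : ℝ) * d ≤ V.card := by
    rw [← B.sum_card_parts, ← hBq]
    exact_mod_cast Finset.card_nsmul_le_sum B.parts (fun s => s.card) d
      (fun x hx => by rcases hB x hx with h | h <;> omega)
  have hU0 : (0 : ℝ) < U.card := lt_of_lt_of_le (by positivity) hcardU
  have hV0 : (0 : ℝ) < V.card := lt_of_lt_of_le (by positivity) hcardV
  have hDnn : (0 : ℝ) ≤ H.edgeDensity U V := by exact_mod_cast H.edgeDensity_nonneg U V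
  have hSnn : 0 ≤ S := Finset.sum_nonneg fun x _ => by
    exact_mod_cast H.edgeDensity_nonneg x.1 x.2
  -- the number of edges
  have hE : (H.edgeDensity U V : ℝ) * (U.card * V.card) ≤ (d + 1) ^ 2 * S := by
    have h1 : (H.edgeDensity U V : ℝ) * (U.card * V.card) = ((H.interedges U V).card : ℝ) := by
      rw [SimpleGraph.edgeDensity_def]
      push_cast
      field_simp
    rw [h1, SimpleGraph.interedges, Rel.card_interedges_finpartition _ A B, hS, Finset.mul_sum]
    push_cast
    refine Finset.sum_le_sum fun ab hab => ?_
    rw [Finset.mem_product] at hab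
    have ha : (ab.1.card : ℝ) ≤ d + 1 := by
      have := hA _ hab.1
      exact_mod_cast (by omega : ab.1.card ≤ d + 1)
    have hb : (ab.2.card : ℝ) ≤ d + 1 := by
      have := hB _ hab.2
      exact_mod_cast (by omega : ab.2.card ≤ d + 1)
    have ha0 : (0 : ℝ) < ab.1.card := by
      have := hA _ hab.1
      exact_mod_cast (by omega : 0 < ab.1.card)
    have hb0 : (0 : ℝ) < ab.2.card := by
      have := hB _ hab.2
      exact_mod_cast (by omega : 0 < ab.2.card)
    have h2 : ((Rel.interedges H.Adj ab.1 ab.2).card : ℝ)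
        = (ab.1.card * ab.2.card) * (H.edgeDensity ab.1 ab.2 : ℝ) := by
      rw [SimpleGraph.edgeDensity_def]
      push_cast
      rw [SimpleGraph.interedges]
      field_simp
    rw [h2]
    have h3 : (0 : ℝ) ≤ H.edgeDensity ab.1 ab.2 := by exact_mod_cast H.edgeDensity_nonneg _ _
    rw [sq]
    gcongr
  have hE2 : ((d : ℝ) / (d + 1)) ^ 2 * (H.edgeDensity U V : ℝ) ≤ S / q ^ 2 := by
    rw [le_div_iff₀ (by positivity), div_pow, div_mul_eq_mul_div, div_mul_eq_mul_div,
      div_le_iff₀ (by positivity)]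
    calc (d : ℝ) ^ 2 * (H.edgeDensity U V : ℝ) * q ^ 2
        = (H.edgeDensity U V : ℝ) * ((q * d) * (q * d)) := by ring
      _ ≤ (H.edgeDensity U V : ℝ) * (U.card * V.card) := by gcongr
      _ ≤ _ := hE
      _ = _ := by ring
  have hcs : S ^ 2 ≤ (q : ℝ) ^ 2 *
      ∑ ab ∈ A.parts ×ˢ B.parts, (H.edgeDensity ab.1 ab.2 : ℝ) ^ 2 := by
    have := sq_sum_le_card_mul_sum_sq (s := A.parts ×ˢ B.parts)
      (f := fun ab => (H.edgeDensity ab.1 ab.2 : ℝ))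
    rw [Finset.card_product, hAq, hBq] at this
    push_cast at this
    rw [sq (q : ℝ)]
    exact this
  calc ((d : ℝ) / (d + 1)) ^ 4 * (H.edgeDensity U V : ℝ) ^ 2
      = (((d : ℝ) / (d + 1)) ^ 2 * (H.edgeDensity U V : ℝ)) ^ 2 := by ring
    _ ≤ (S / q ^ 2) ^ 2 := by gcongr
    _ = S ^ 2 / q ^ 2 / q ^ 2 := by field_simp
    _ ≤ _ := by
      gcongr
      rw [div_le_iff₀ (by positivity)]
      linarith [hcs]

open Finset Fintype SzemerediRegularity Finpartition in
/-- The increment partition built from `G` essentially does not decrease the energy of an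
arbitrary graph `H`. -/
theorem mcr_energy_stable {α : Type*} [Fintype α] [DecidableEq α]
    {P : Finpartition (univ : Finset α)} (hP : P.IsEquipartition)
    (G : SimpleGraph α) [DecidableRel G.Adj] (H : SimpleGraph α) [DecidableRel H.Adj] (ε : ℝ)
    (hPα : P.parts.card * 16 ^ P.parts.card ≤ card α) (hPG : ¬P.IsUniform G ε)
    (d : ℕ) (hdef : d = card α / stepBound P.parts.card) (hd : 0 < d) :
    ((d : ℝ) / (d + 1)) ^ 4 * (P.energy H : ℝ) ≤ ((increment hP G ε).energy H : ℝ) := by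
  classical
  let D : {x // x ∈ P.parts.offDiag} → Finset (Finset α × Finset α) := fun x =>
    (chunk hP G ε (mem_offDiag.1 x.2).1).parts ×ˢ (chunk hP G ε (mem_offDiag.1 x.2).2.1).parts
  have hsub : P.parts.offDiag.attach.biUnion D ⊆ (increment hP G ε).parts.offDiag := by
    rintro ⟨Ui, Vj⟩
    simp only [D, increment, mem_offDiag, bind_parts, mem_biUnion, Prod.exists,
      mem_product, mem_attach, true_and, Subtype.exists, and_imp,
      mem_offDiag, forall_exists_index, Ne]
    refine fun U V hUV hUi hVj => ⟨⟨_, hUV.1, hUi⟩, ⟨_, hUV.2.1, hVj⟩, ?_⟩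
    rintro rfl
    obtain ⟨i, hi⟩ := nonempty_of_mem_parts _ hUi
    exact hUV.2.2 (P.disjoint.elim_finset hUV.1 hUV.2.1 i (Finpartition.le _ hUi hi) <|
      Finpartition.le _ hVj hi)
  have hdisj : (P.parts.offDiag.attach : Set {x // x ∈ P.parts.offDiag}).PairwiseDisjoint D := by
    simp +unfoldPartialApp only [D, Set.PairwiseDisjoint,
      Function.onFun, Finset.disjoint_left, mem_product]
    rintro ⟨⟨s₁, s₂⟩, hs⟩ _ ⟨⟨t₁, t₂⟩, ht⟩ _ hst ⟨u, v⟩ huv₁ huv₂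
    rw [mem_offDiag] at hs ht
    obtain ⟨a, ha⟩ := Finpartition.nonempty_of_mem_parts _ huv₁.1
    obtain ⟨b, hb⟩ := Finpartition.nonempty_of_mem_parts _ huv₁.2
    exact hst <| Subtype.ext <| Prod.ext
      (P.disjoint.elim_finset hs.1 ht.1 a (Finpartition.le _ huv₁.1 ha) <|
        Finpartition.le _ huv₂.1 ha) <|
          P.disjoint.elim_finset hs.2.1 ht.2.1 b (Finpartition.le _ huv₁.2 hb) <|
            Finpartition.le _ huv₂.2 hb
  have hcard : ∀ (U : Finset α) (hU : U ∈ P.parts),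
      (chunk hP G ε hU).parts.card = 4 ^ P.parts.card :=
    fun U hU => card_chunk (by rw [← hdef]; exact hd.ne')
  have hpart : ∀ (U : Finset α) (hU : U ∈ P.parts), ∀ s ∈ (chunk hP G ε hU).parts,
      s.card = d ∨ s.card = d + 1 := fun U hU s hs => by
    rw [hdef]; exact card_eq_of_mem_parts_chunk hs
  rw [coe_energy, coe_energy, card_increment hPα hPG, ← mul_div_assoc]
  calc ((d : ℝ) / (d + 1)) ^ 4 * (∑ uv ∈ P.parts.offDiag, (H.edgeDensity uv.1 uv.2 : ℝ) ^ 2) /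
        (P.parts.card : ℝ) ^ 2
      = (∑ x ∈ P.parts.offDiag.attach,
          ((d : ℝ) / (d + 1)) ^ 4 * (H.edgeDensity x.1.1 x.1.2 : ℝ) ^ 2) /
          (P.parts.card : ℝ) ^ 2 := by
        rw [Finset.mul_sum, ← sum_attach]
    _ ≤ (∑ x ∈ P.parts.offDiag.attach, (∑ i ∈ D x, (H.edgeDensity i.1 i.2 : ℝ) ^ 2) /
          (((4 ^ P.parts.card : ℕ) : ℝ) ^ 2)) / (P.parts.card : ℝ) ^ 2 := by
        gcongr with x hx
        exact mcr_chunk_aux H _ _ d (4 ^ P.parts.card) hd (by positivity)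
          (hpart _ _) (hpart _ _) (hcard _ _) (hcard _ _)
    _ = (∑ i ∈ P.parts.offDiag.attach.biUnion D, (H.edgeDensity i.1 i.2 : ℝ) ^ 2) /
          ((stepBound P.parts.card : ℕ) : ℝ) ^ 2 := by
        rw [sum_biUnion hdisj, ← sum_div, div_div, stepBound]
        push_cast
        ring
    _ ≤ _ := by
        gcongr

open Finset Fintype SzemerediRegularity Finpartition in
/-- Simultaneous regularity lemma for a finite family of graphs. -/
theorem mcr_family (ε : ℝ) (hε : 0 < ε) (hε₁ : ε ≤ 1) (c l : ℕ) (hc : 0 < c) :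
    ∃ M N₀ : ℕ, ∀ n : ℕ, N₀ ≤ n → ∀ (H : Fin c → SimpleGraph (Fin n))
      [∀ s, DecidableRel (H s).Adj],
      ∃ P : Finpartition (univ : Finset (Fin n)), P.IsEquipartition ∧ l ≤ P.parts.card ∧
        P.parts.card ≤ M ∧ ∀ s, P.IsUniform (H s) ε := by
  have hc' : (0 : ℝ) < c := by exact_mod_cast hc
  set t := initialBound ε l with ht
  set I : ℕ := ⌊8 * c / ε ^ 5⌋₊ + 1 with hI
  set M : ℕ := stepBound^[I] t with hM
  obtain ⟨D, hD⟩ : ∃ D : ℕ, 32 * c / ε ^ 5 ≤ (D : ℝ) := exists_nat_ge _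
  have hmono : ∀ i ≤ I, stepBound^[i] t ≤ M := fun i hi =>
    Function.monotone_iterate_of_id_le (fun x => le_stepBound x) hi t
  have htpos : 0 < t := initialBound_pos _ _
  have htM : t ≤ M := hmono 0 (Nat.zero_le _)
  refine ⟨M, M * 16 ^ M + (D + 1) * stepBound M, fun n hn H _ => ?_⟩
  have hMn : M * 16 ^ M ≤ n := by omega
  have hMn' : M ≤ n := le_trans (Nat.le_mul_of_pos_right _ (by positivity)) hMn
  have : Nonempty (Fin n) := ⟨⟨0, by omega⟩⟩
  obtain ⟨dum, hdum₁, hdum₂⟩ :=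
    exists_equipartition_card_eq (univ : Finset (Fin n)) (initialBound_pos ε l).ne'
      (by rw [Finset.card_univ, Fintype.card_fin]; exact htM.trans hMn')
  suffices h : ∀ i ≤ I, ∃ P : Finpartition (univ : Finset (Fin n)), P.IsEquipartition ∧
      t ≤ P.parts.card ∧ P.parts.card ≤ stepBound^[i] t ∧
      ((∀ s, P.IsUniform (H s) ε) ∨ ε ^ 5 / 8 * i ≤ ∑ s, (P.energy (H s) : ℝ)) by
    obtain ⟨P, hP₁, hP₂, hP₃, hP₄⟩ := h I le_rfl
    refine ⟨P, hP₁, (le_initialBound _ _).trans hP₂, hP₃,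
      hP₄.resolve_right fun hPenergy => lt_irrefl (c : ℝ) ?_⟩
    calc (c : ℝ) = ε ^ 5 / 8 * (8 * c / ε ^ 5) := by field_simp
      _ < ε ^ 5 / 8 * I := by
        gcongr
        rw [hI]; push_cast; exact Nat.lt_floor_add_one _
      _ ≤ _ := hPenergy
      _ ≤ ∑ s : Fin c, (1 : ℝ) := Finset.sum_le_sum fun s _ => by
        exact_mod_cast P.energy_le_one (H s)
      _ = c := by simp
  intro i
  induction i with
  | zero =>
    intro _
    refine ⟨dum, hdum₁, hdum₂.ge, hdum₂.le, Or.inr ?_⟩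
    rw [Nat.cast_zero, mul_zero]
    exact Finset.sum_nonneg fun s _ => by exact_mod_cast dum.energy_nonneg (H s)
  | succ i ih =>
    intro hi
    obtain ⟨P, hP₁, hP₂, hP₃, hP₄⟩ := ih (by omega)
    by_cases huniform : ∀ s, P.IsUniform (H s) ε
    · refine ⟨P, hP₁, hP₂, ?_, Or.inl huniform⟩
      rw [Function.iterate_succ_apply']
      exact hP₃.trans (le_stepBound _)
    replace hP₄ := hP₄.resolve_left huniform
    push Not at huniform
    obtain ⟨s₀, hs₀⟩ := huniform
    have hPM : P.parts.card ≤ M := hP₃.trans (hmono i (by omega))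
    have hPα : P.parts.card * 16 ^ P.parts.card ≤ card (Fin n) := by
      rw [Fintype.card_fin]
      refine le_trans ?_ hMn
      gcongr
      norm_num
    have hcardinc := card_increment (hP := hP₁) hPα hs₀
    refine ⟨increment hP₁ (H s₀) ε, increment_isEquipartition hP₁ (H s₀) ε, ?_, ?_, Or.inr ?_⟩
    · rw [hcardinc]; exact hP₂.trans (le_stepBound _)
    · rw [hcardinc, Function.iterate_succ_apply']; exact stepBound_mono hP₃
    have hinc := energy_increment (G := H s₀) hP₁
      ((seven_le_initialBound ε l).trans hP₂)
      ((hundred_lt_pow_initialBound_mul hε l).le.trans (by gcongr; norm_num)) hPα hs₀ hε.le hε₁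
    set d := card (Fin n) / stepBound P.parts.card with hd
    have hdD : D + 1 ≤ d := by
      rw [hd, Nat.le_div_iff_mul_le (stepBound_pos (by omega)), Fintype.card_fin]
      calc (D + 1) * stepBound P.parts.card ≤ (D + 1) * stepBound M := by
            gcongr; exact stepBound_mono hPM
        _ ≤ n := by omega
    have hdpos : (0 : ℝ) < (d : ℝ) + 1 := by positivity
    have hfac : 1 - ε ^ 5 / (8 * c) ≤ ((d : ℝ) / (d + 1)) ^ 4 := by
      have h1 : (d : ℝ) / (d + 1) = 1 + (-(1 / (d + 1))) := by field_simp; ring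
      have h2 : (1 : ℝ) / (d + 1) ≤ 1 := by
        rw [div_le_one hdpos]; linarith [(Nat.cast_nonneg d : (0 : ℝ) ≤ d)]
      have h3 := one_add_mul_le_pow (a := -(1 / ((d : ℝ) + 1))) (by linarith) 4
      rw [h1]
      refine le_trans ?_ h3
      have h4 : 32 * c / ε ^ 5 ≤ (d : ℝ) + 1 := by
        have : ((D + 1 : ℕ) : ℝ) ≤ d := by exact_mod_cast hdD
        push_cast at this
        linarith
      have h5 : 1 / ((d : ℝ) + 1) ≤ ε ^ 5 / (32 * c) := by
        rw [div_le_iff₀ (by positivity)] at h4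
        rw [div_le_div_iff₀ hdpos (by positivity)]
        linarith
      have h6 : ε ^ 5 / (8 * c) = 4 * (ε ^ 5 / (32 * c)) := by field_simp; norm_num
      push_cast
      rw [h6]
      linarith
    have hst : ∀ s, (P.energy (H s) : ℝ) - ε ^ 5 / (8 * c) ≤
        ((increment hP₁ (H s₀) ε).energy (H s) : ℝ) := fun s => by
      have h1 := mcr_energy_stable hP₁ (H s₀) (H s) ε hPα hs₀ d hd (by omega)
      have h2 : (0 : ℝ) ≤ P.energy (H s) := by exact_mod_cast P.energy_nonneg (H s)
      have h3 : (P.energy (H s) : ℝ) ≤ 1 := by exact_mod_cast P.energy_le_one (H s)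
      have h4 := mul_le_mul_of_nonneg_right hfac h2
      have h5 : 0 ≤ ε ^ 5 / (8 * c) := by positivity
      have h6 := mul_le_mul_of_nonneg_left h3 h5
      linarith
    have hsum : ∑ s, ((P.energy (H s) : ℝ) - ε ^ 5 / (8 * c) +
        (if s = s₀ then ε ^ 5 / 4 else 0)) ≤
        ∑ s, ((increment hP₁ (H s₀) ε).energy (H s) : ℝ) := by
      refine Finset.sum_le_sum fun s _ => ?_
      split_ifs with h
      · subst h
        have : 0 ≤ ε ^ 5 / (8 * c) := by positivity
        linarith
      · linarith [hst s]
    rw [Finset.sum_add_distrib, Finset.sum_sub_distrib, Finset.sum_ite_eq' univ s₀,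
      if_pos (Finset.mem_univ _), Finset.sum_const, Finset.card_univ, Fintype.card_fin,
      nsmul_eq_mul] at hsum
    have h8 : (c : ℝ) * (ε ^ 5 / (8 * c)) = ε ^ 5 / 8 := by field_simp
    rw [h8] at hsum
    rw [Nat.cast_succ]
    linarith

/-- The graph of edges of color `s`. -/
def mcrColorGraph {n c : ℕ} (G : SimpleGraph (Fin n)) (χ : Sym2 (Fin n) → Fin c) (s : Fin c) :
    SimpleGraph (Fin n) where
  Adj a b := G.Adj a b ∧ χ s(a, b) = s
  symm := ⟨fun a b h => ⟨h.1.symm, by rw [Sym2.eq_swap]; exact h.2⟩⟩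
  loopless := ⟨fun a h => G.loopless.irrefl a h.1⟩

theorem mcr_colorDensity {n c : ℕ} (G : SimpleGraph (Fin n)) (χ : Sym2 (Fin n) → Fin c)
    (s : Fin c) [DecidableRel (mcrColorGraph G χ s).Adj] (X Y : Finset (Fin n)) :
    colorDensity G χ s X Y = ((mcrColorGraph G χ s).edgeDensity X Y : ℝ) := by
  rw [colorDensity, SimpleGraph.edgeDensity_def]
  push_cast
  congr 2
  rw [← Set.ncard_coe_finset]
  congr 1
  ext p
  rw [Finset.mem_coe, SimpleGraph.mem_interedges_iff]
  exact Iff.rfl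

/-- Multicolor Szemerédi regularity lemma: for every `ε > 0` and positive integers
`c, m` there are `M, N₀` such that every `c`-edge-colored graph on `n ≥ N₀` vertices
admits an equipartite partition `A₁, …, A_k` with `m ≤ k ≤ M` in which all but at
most `ε·k²` of the pairs `(A_i, A_j)` with `i < j` are `ε`-regular in every color. -/
theorem multicolor_regularity_lemma (ε : ℝ) (hε : 0 < ε) (c m : ℕ)
    (hc : 0 < c) (hm : 0 < m) :
    ∃ M N₀ : ℕ, ∀ n : ℕ, N₀ ≤ n →
      ∀ (G : SimpleGraph (Fin n)) (χ : Sym2 (Fin n) → Fin c),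
        ∃ k : ℕ, m ≤ k ∧ k ≤ M ∧
          ∃ A : Fin k → Finset (Fin n),
            (∀ i j, i ≠ j → Disjoint (A i) (A j)) ∧
            (∀ v : Fin n, ∃ i, v ∈ A i) ∧
            (∀ i j, ((A i).card : ℤ) - ((A j).card : ℤ) ≤ 1) ∧
            (({p : Fin k × Fin k |
                p.1 < p.2 ∧ ¬ IsMulticolorRegularPair G χ ε (A p.1) (A p.2)}.ncard : ℝ)
              ≤ ε * (k : ℝ) ^ 2) := by
  classical
  have hc' : (0 : ℝ) < c := by exact_mod_cast hc
  have hc1 : (1 : ℝ) ≤ c := by exact_mod_cast hc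
  set δ : ℝ := min ε 1 / c with hδ
  have hmin : 0 < min ε 1 := lt_min hε one_pos
  have hδ0 : 0 < δ := by positivity
  have hδm : δ ≤ min ε 1 := div_le_self hmin.le hc1
  have hδε : δ ≤ ε := hδm.trans (min_le_left _ _)
  have hδ1 : δ ≤ 1 := hδm.trans (min_le_right _ _)
  have hδc : c * δ ≤ ε := by
    rw [hδ, mul_div_cancel₀ _ hc'.ne']
    exact min_le_left _ _
  obtain ⟨M, N₀, h⟩ := mcr_family δ hδ0 hδ1 c m hc
  refine ⟨M, N₀, fun n hn G χ => ?_⟩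
  obtain ⟨P, hP, hm', hM, hU⟩ := h n hn (fun s => mcrColorGraph G χ s)
  let e := P.parts.equivFin.symm
  refine ⟨P.parts.card, hm', hM, fun i => (e i : Finset (Fin n)), ?_, ?_, ?_, ?_⟩
  · intro i j hij
    exact P.disjoint (e i).2 (e j).2 fun h => hij (e.injective (Subtype.ext h))
  · intro v
    obtain ⟨A, hA, hv⟩ := P.exists_mem (Finset.mem_univ v)
    exact ⟨e.symm ⟨A, hA⟩, by simpa using hv⟩
  · intro i j
    have h1 : (e i : Finset (Fin n)).card ≤ (e j : Finset (Fin n)).card + 1 :=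
      hP (e i).2 (e j).2
    show ((e i : Finset (Fin n)).card : ℤ) - ((e j : Finset (Fin n)).card : ℤ) ≤ 1
    omega
  · have hle : ({p : Fin P.parts.card × Fin P.parts.card | p.1 < p.2 ∧
        ¬ IsMulticolorRegularPair G χ ε (e p.1 : Finset (Fin n)) (e p.2)}).ncard ≤
        (Finset.univ.biUnion fun s => P.nonUniforms (mcrColorGraph G χ s) δ).card := by
      rw [← Set.ncard_coe_finset
        (Finset.univ.biUnion fun s => P.nonUniforms (mcrColorGraph G χ s) δ)]
      refine Set.ncard_le_ncard_of_injOn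
        (fun p => ((e p.1 : Finset (Fin n)), (e p.2 : Finset (Fin n)))) ?_ ?_
        (Finset.finite_toSet _)
      · rintro ⟨i, j⟩ ⟨hij, hreg⟩
        simp only [Finset.coe_biUnion, Set.mem_iUnion, Finset.mem_coe, Finset.mem_univ,
          Finpartition.mk_mem_nonUniforms, exists_prop, true_and]
        by_contra hcon
        push Not at hcon
        apply hreg
        intro s X hX Y hY hXc hYc
        have hne : (e i : Finset (Fin n)) ≠ e j := fun h =>
          (ne_of_lt hij) (e.injective (Subtype.ext h))
        have hu := (hcon s (e i).2 (e j).2 hne).mono hδε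
        rw [mcr_colorDensity, mcr_colorDensity]
        exact hu hX hY (by rw [mul_comm]; exact hXc) (by rw [mul_comm]; exact hYc)
      · rintro ⟨i, j⟩ _ ⟨i', j'⟩ _ hEq
        simp only [Prod.mk.injEq] at hEq ⊢
        exact ⟨e.injective (Subtype.ext hEq.1), e.injective (Subtype.ext hEq.2)⟩
    calc _ ≤ ((Finset.univ.biUnion fun s =>
          P.nonUniforms (mcrColorGraph G χ s) δ).card : ℝ) := by exact_mod_cast hle
      _ ≤ ∑ s : Fin c, ((P.nonUniforms (mcrColorGraph G χ s) δ).card : ℝ) := by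
        exact_mod_cast Finset.card_biUnion_le
      _ ≤ ∑ s : Fin c, (P.parts.card : ℝ) ^ 2 * δ := by
        refine Finset.sum_le_sum fun s _ => (hU s).trans ?_
        have : ((P.parts.card * (P.parts.card - 1) : ℕ) : ℝ) ≤ (P.parts.card : ℝ) ^ 2 := by
          rw [sq]
          exact_mod_cast Nat.mul_le_mul_left _ (Nat.sub_le _ 1)
        gcongr
      _ = (c * δ) * (P.parts.card : ℝ) ^ 2 := by
        rw [Finset.sum_const, Finset.card_univ, Fintype.card_fin, nsmul_eq_mul]; ring
      _ ≤ ε * (P.parts.card : ℝ) ^ 2 := by gcongr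
end
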